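/- arXiv:2401.17265 — 2 statements merged into one kernel-verified Lean document; each statement's English description precedes it below -/
import Mathlib

section
/- Let ρ: L^∞ → ℝ be a Fatou-continuous coherent risk measure and 𝓖 ⊆ 𝓕 a sub-σ-algebra. Then the restriction ρ̃ = ρ|_{L^∞(𝓖)} is a Fatou-continuous coherent risk measure on L^∞(𝓖), the restricted supporting set 𝒮_ρ^𝓖 = {μ|_𝓖 : μ ∈ 𝒮_ρ} is contained in 𝒮_{ρ̃}, and 𝒮_ρ^𝓖 is dense in 𝒮_{ρ̃} with respect to the weak topology w(𝓜(𝓖), L^∞(𝓖)). -/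
open MeasureTheory

/-- Membership in the supporting set of ρ, identified with densities of probability
measures absolutely continuous with respect to ℙ. -/
def SuppMem {Ω : Type*} {mΩ : MeasurableSpace Ω} (ℙ : Measure Ω) (ρ : (Ω → ℝ) → ℝ)
    (D : Ω → ℝ) : Prop :=
  Measurable D ∧ (∀ᵐ ω ∂ℙ, 0 ≤ D ω) ∧ Integrable D ℙ ∧ (∫ ω, D ω ∂ℙ) = 1 ∧
    ∀ X : Ω → ℝ, Measurable X → (∃ C : ℝ, ∀ ω, |X ω| ≤ C) → (∫ ω, D ω * X ω ∂ℙ) ≤ ρ X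

/-- Membership in the supporting set of the restriction of ρ to L^∞(𝓖), identified with
𝓖-measurable densities of probability measures on (Ω,𝓖) absolutely continuous w.r.t. ℙ|_𝓖. -/
def SuppMemG {Ω : Type*} (m : MeasurableSpace Ω) {mΩ : MeasurableSpace Ω} (ℙ : Measure Ω)
    (ρ : (Ω → ℝ) → ℝ) (E : Ω → ℝ) : Prop :=
  StronglyMeasurable[m] E ∧ (∀ᵐ ω ∂ℙ, 0 ≤ E ω) ∧ Integrable E ℙ ∧ (∫ ω, E ω ∂ℙ) = 1 ∧
    ∀ X : Ω → ℝ, StronglyMeasurable[m] X → (∃ C : ℝ, ∀ ω, |X ω| ≤ C) →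
      (∫ ω, E ω * X ω ∂ℙ) ≤ ρ X

section

open Set Filter Topology

/-- In an inner product space, a decreasing sequence of nonempty, convex, uniformly bounded sets
admits a Cauchy selection. -/
theorem exists_cauchySeq_mem_of_antitone_convex {H : Type*} [NormedAddCommGroup H]
    [InnerProductSpace ℝ H] {T : ℕ → Set H} (hanti : Antitone T) (hne : ∀ n, (T n).Nonempty)
    (hconv : ∀ n, Convex ℝ (T n)) {R : ℝ} (hR : ∀ n, ∀ x ∈ T n, ‖x‖ ≤ R) :
    ∃ x : ℕ → H, (∀ n, x n ∈ T n) ∧ CauchySeq x := by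
  let d : ℕ → ℝ := fun n => sInf ((fun x : H => ‖x‖ ^ 2) '' T n)
  have hbdd : ∀ n, BddBelow ((fun x : H => ‖x‖ ^ 2) '' T n) := fun n =>
    ⟨0, by rintro _ ⟨x, -, rfl⟩; positivity⟩
  have hd_le : ∀ n, ∀ x ∈ T n, d n ≤ ‖x‖ ^ 2 := fun n x hx =>
    csInf_le (hbdd n) (mem_image_of_mem _ hx)
  have hd_mono : Monotone d := fun n k hnk =>
    csInf_le_csInf (hbdd n) ((hne k).image _) (image_mono (hanti hnk))
  have hd_bdd : BddAbove (range d) := by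
    refine ⟨R ^ 2, ?_⟩
    rintro _ ⟨n, rfl⟩
    obtain ⟨x, hx⟩ := hne n
    exact (hd_le n x hx).trans (pow_le_pow_left₀ (norm_nonneg x) (hR n x hx) 2)
  have hlim : Tendsto d atTop (𝓝 (⨆ n, d n)) := tendsto_atTop_ciSup hd_mono hd_bdd
  have hsel : ∀ n : ℕ, ∃ x ∈ T n, ‖x‖ ^ 2 < d n + 1 / ((n : ℝ) + 1) := by
    intro n
    obtain ⟨_, ⟨x, hx, rfl⟩, hlt⟩ := exists_lt_of_csInf_lt ((hne n).image (fun x : H => ‖x‖ ^ 2))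
      (lt_add_of_pos_right (d n) (by positivity : 0 < 1 / ((n : ℝ) + 1)))
    exact ⟨x, hx, hlt⟩
  choose x hxT hxd using hsel
  refine ⟨x, hxT, cauchySeq_of_le_tendsto_0'
    (fun n => √(2 * ((⨆ n, d n) - d n) + 4 * (1 / ((n : ℝ) + 1)))) ?_ ?_⟩
  · intro n k hnk
    rw [dist_eq_norm]
    refine Real.le_sqrt_of_sq_le ?_
    have hmid : (1 / 2 : ℝ) • x n + (1 / 2 : ℝ) • x k ∈ T n :=
      hconv n (hxT n) (hanti hnk (hxT k)) (by norm_num) (by norm_num) (by norm_num)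
    have h1 := hd_le n _ hmid
    rw [← smul_add, norm_smul, mul_pow] at h1
    norm_num at h1
    have h2 := parallelogram_law_with_norm ℝ (x n) (x k)
    have h3 : d k ≤ ⨆ n, d n := le_ciSup hd_bdd k
    have h4 : 1 / ((k : ℝ) + 1) ≤ 1 / ((n : ℝ) + 1) := by gcongr
    have h5 := hxd n
    have h6 := hxd k
    nlinarith
  · have h : Tendsto (fun n : ℕ => 2 * ((⨆ n, d n) - d n) + 4 * (1 / ((n : ℝ) + 1))) atTop
        (𝓝 (2 * ((⨆ n, d n) - ⨆ n, d n) + 4 * 0)) :=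
      ((tendsto_const_nhds.sub hlim).const_mul 2).add
        (tendsto_one_div_add_atTop_nhds_zero_nat.const_mul 4)
    have h' := h.sqrt
    simpa using h'

variable {Ω : Type*} [MeasurableSpace Ω]

/-- A decreasing sequence of nonempty convex sets of uniformly bounded measurable functions admits
an almost everywhere convergent selection. -/
theorem exists_ae_tendsto_mem_of_antitone_convex (P : Measure Ω) [IsFiniteMeasure P]
    {S : ℕ → Set (Ω → ℝ)} (hanti : Antitone S) (hne : ∀ n, (S n).Nonempty)
    (hconv : ∀ n, Convex ℝ (S n)) (hmeas : ∀ n, ∀ Y ∈ S n, Measurable Y) {K : ℝ}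
    (hK : ∀ n, ∀ Y ∈ S n, ∀ ω, |Y ω| ≤ K) :
    ∃ (Ys : ℕ → Ω → ℝ) (Y : Ω → ℝ), (∀ n, Ys n ∈ S n) ∧ Measurable Y ∧ (∀ ω, |Y ω| ≤ max K 0) ∧
      ∀ᵐ ω ∂P, Tendsto (fun n => Ys n ω) atTop (𝓝 (Y ω)) := by
  have hLp : ∀ n, ∀ Y ∈ S n, MemLp Y 2 P := fun n Y hY =>
    MemLp.of_bound (hmeas n Y hY).aestronglyMeasurable K (ae_of_all _ (hK n Y hY))
  let T : ℕ → Set (Lp ℝ 2 P) := fun n => {x | ∃ Y ∈ S n, x =ᵐ[P] Y}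
  obtain ⟨x, hxT, hx⟩ := exists_cauchySeq_mem_of_antitone_convex (T := T)
    (R := P.real univ ^ (2 : ENNReal).toReal⁻¹ * max K 0)
    (fun n k hnk x ⟨Y, hY, hxY⟩ => ⟨Y, hanti hnk hY, hxY⟩)
    (fun n => by
      obtain ⟨Y, hY⟩ := hne n
      exact ⟨(hLp n Y hY).toLp Y, Y, hY, MemLp.coeFn_toLp _⟩)
    (fun n => by
      rintro x ⟨Y, hY, hxY⟩ x' ⟨Y', hY', hxY'⟩ a b ha hb hab
      refine ⟨a • Y + b • Y', hconv n hY hY' ha hb hab, ?_⟩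
      filter_upwards [Lp.coeFn_add (a • x) (b • x'), Lp.coeFn_smul a x, Lp.coeFn_smul b x', hxY,
        hxY'] with ω h1 h2 h3 h4 h5
      rw [h1, Pi.add_apply, h2, h3]
      simp [h4, h5])
    (fun n => by
      rintro x ⟨Y, hY, hxY⟩
      refine Lp.norm_le_of_ae_bound (le_max_right _ _) ?_
      filter_upwards [hxY] with ω h
      rw [h]
      exact (hK n Y hY ω).trans (le_max_left _ _))
  obtain ⟨z, hz⟩ := cauchySeq_tendsto_of_complete hx
  obtain ⟨ns, hns, hae⟩ := (tendstoInMeasure_of_tendsto_Lp hz).exists_seq_tendsto_ae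
  choose Y hYS hxY using hxT
  refine ⟨fun n => Y (ns n), fun ω => max (-max K 0) (min (max K 0) (z ω)),
    fun n => hanti (hns.id_le n) (hYS (ns n)), ?_, fun ω => ?_, ?_⟩
  · exact measurable_const.max (measurable_const.min (Lp.stronglyMeasurable z).measurable)
  · have h0 : 0 ≤ max K 0 := le_max_right _ _
    exact abs_le.2 ⟨le_max_left _ _, max_le (by linarith) (min_le_left _ _)⟩
  · filter_upwards [hae, ae_all_iff.2 hxY] with ω h1 h2
    have h3 : Tendsto (fun n => Y (ns n) ω) atTop (𝓝 (z ω)) := by simpa only [h2] using h1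
    have h4 : ∀ n, |Y (ns n) ω| ≤ max K 0 := fun n =>
      (hK _ _ (hYS (ns n)) ω).trans (le_max_left _ _)
    have h5 : |z ω| ≤ max K 0 := le_of_tendsto' h3.abs h4
    rw [abs_le] at h5
    rwa [min_eq_right h5.2, max_eq_right h5.1]

/-- Bounded convergence for the composition with a continuous function. -/
theorem tendsto_integral_comp_of_abs_le (P : Measure Ω) [IsFiniteMeasure P] {h : ℝ → ℝ}
    (hh : Continuous h) {Ys : ℕ → Ω → ℝ} {Y : Ω → ℝ} (hYs : ∀ n, Measurable (Ys n)) {K : ℝ}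
    (hK : ∀ n ω, |Ys n ω| ≤ K) (hlim : ∀ᵐ ω ∂P, Tendsto (fun n => Ys n ω) atTop (𝓝 (Y ω))) :
    Tendsto (fun n => ∫ ω, h (Ys n ω) ∂P) atTop (𝓝 (∫ ω, h (Y ω) ∂P)) := by
  obtain ⟨M, hM⟩ := isCompact_Icc.exists_bound_of_continuousOn (s := Icc (-K) K) hh.continuousOn
  refine tendsto_integral_of_dominated_convergence (fun _ => M)
    (fun n => (hh.measurable.comp (hYs n)).aestronglyMeasurable) (integrable_const M)
    (fun n => ae_of_all _ fun ω => hM _ (abs_le.1 (hK n ω))) ?_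
  filter_upwards [hlim] with ω hω
  exact (hh.tendsto _).comp hω

theorem integrable_comp_of_abs_le (P : Measure Ω) [IsFiniteMeasure P] {h : ℝ → ℝ}
    (hh : Continuous h) {Y : Ω → ℝ} (hY : Measurable Y) {K : ℝ} (hK : ∀ ω, |Y ω| ≤ K) :
    Integrable (fun ω => h (Y ω)) P := by
  obtain ⟨M, hM⟩ := isCompact_Icc.exists_bound_of_continuousOn (s := Icc (-K) K) hh.continuousOn
  exact Integrable.of_bound (hh.measurable.comp hY).aestronglyMeasurable M
    (ae_of_all _ fun ω => hM _ (abs_le.1 (hK ω)))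

/-- Nonnegative convex functions on the real line that vanish on the negative half-line. -/
structure IsPenalty (f : ℝ → ℝ) : Prop where
  convexOn : ConvexOn ℝ univ f
  nonneg : ∀ y, 0 ≤ f y
  eq_zero : ∀ y ≤ 0, f y = 0

namespace IsPenalty

variable {f : ℝ → ℝ}

theorem continuous (hf : IsPenalty f) : Continuous f :=
  continuousOn_univ.1 (hf.convexOn.continuousOn isOpen_univ)

theorem apply_mul_le (hf : IsPenalty f) {s : ℝ} (hs : 0 ≤ s) (hs1 : s ≤ 1) (y : ℝ) :
    f (s * y) ≤ s * f y := by
  simpa [hf.eq_zero 0 le_rfl] using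
    hf.convexOn.2 (mem_univ y) (mem_univ 0) hs (sub_nonneg.2 hs1) (add_sub_cancel s 1)

theorem monotone (hf : IsPenalty f) : Monotone f := by
  intro x y hxy
  rcases le_or_gt y 0 with hy | hy
  · rw [hf.eq_zero y hy, hf.eq_zero x (hxy.trans hy)]
  rcases le_or_gt x 0 with hx | hx
  · rw [hf.eq_zero x hx]
    exact hf.nonneg y
  · have h1 : x / y ≤ 1 := (div_le_one hy).2 hxy
    have h := hf.apply_mul_le (div_pos hx hy).le h1 y
    rw [div_mul_cancel₀ x hy.ne'] at h
    exact h.trans (mul_le_of_le_one_left (hf.nonneg y) h1)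

theorem zero : IsPenalty fun _ => 0 :=
  ⟨convexOn_const 0 convex_univ, fun _ => le_rfl, fun _ _ => rfl⟩

theorem add_mul_max (hf : IsPenalty f) {k a : ℝ} (hk : 0 ≤ k) (ha : 0 ≤ a) :
    IsPenalty fun y => f y + k * max (y - a) 0 where
  convexOn := by
    refine hf.convexOn.add ⟨convex_univ, fun x _ y _ s t hs ht hst => ?_⟩
    simp only [smul_eq_mul]
    have h : max (s * x + t * y - a) 0 ≤ s * max (x - a) 0 + t * max (y - a) 0 := by
      refine max_le ?_ (by positivity)
      have h1 := mul_le_mul_of_nonneg_left (le_max_left (x - a) 0) hs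
      have h2 := mul_le_mul_of_nonneg_left (le_max_left (y - a) 0) ht
      have h3 : a = s * a + t * a := by rw [← add_mul, hst, one_mul]
      linarith
    have := mul_le_mul_of_nonneg_left h hk
    linarith
  nonneg y := by
    have := hf.nonneg y
    positivity
  eq_zero y hy := by
    rw [hf.eq_zero y hy, max_eq_right (by linarith), mul_zero, add_zero]

theorem convex_sublevel (hf : IsPenalty f) (P : Measure Ω) [IsFiniteMeasure P] {a b c : ℝ}
    {X Y : Ω → ℝ} (hX : Measurable X) (hY : Measurable Y) {K L : ℝ} (hK : ∀ ω, |X ω| ≤ K)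
    (hL : ∀ ω, |Y ω| ≤ L) (ha : 0 ≤ a) (hb : 0 ≤ b) (hab : a + b = 1)
    (hXc : ∫ ω, f (X ω) ∂P ≤ c) (hYc : ∫ ω, f (Y ω) ∂P ≤ c) :
    ∫ ω, f (a * X ω + b * Y ω) ∂P ≤ c := by
  have hiX := integrable_comp_of_abs_le P hf.continuous hX hK
  have hiY := integrable_comp_of_abs_le P hf.continuous hY hL
  have hi : Integrable (fun ω => f (a * X ω + b * Y ω)) P := by
    refine integrable_comp_of_abs_le P hf.continuous ((hX.const_mul a).add (hY.const_mul b))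
      (K := a * K + b * L) fun ω => ?_
    refine (abs_add_le _ _).trans ?_
    rw [abs_mul, abs_mul, abs_of_nonneg ha, abs_of_nonneg hb]
    have := hK ω
    have := hL ω
    gcongr
  calc ∫ ω, f (a * X ω + b * Y ω) ∂P
      ≤ ∫ ω, (a * f (X ω) + b * f (Y ω)) ∂P :=
        integral_mono hi ((hiX.const_mul a).add (hiY.const_mul b)) fun ω =>
          hf.convexOn.2 (mem_univ _) (mem_univ _) ha hb hab
    _ = a * ∫ ω, f (X ω) ∂P + b * ∫ ω, f (Y ω) ∂P := by
        rw [integral_add (hiX.const_mul a) (hiY.const_mul b), integral_const_mul,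
          integral_const_mul]
    _ ≤ a * c + b * c := by gcongr
    _ = c := by rw [← add_mul, hab, one_mul]

end IsPenalty

/-- Convex solid sets of bounded measurable functions which are closed under bounded almost
everywhere convergence. -/
structure IsFatouClosedUpper (P : Measure Ω) (C : Set (Ω → ℝ)) : Prop where
  measurable : ∀ Y ∈ C, Measurable Y
  bounded : ∀ Y ∈ C, ∃ K : ℝ, ∀ ω, |Y ω| ≤ K
  convex : Convex ℝ C
  upper : ∀ Y ∈ C, ∀ Y', Measurable Y' → (∃ K : ℝ, ∀ ω, |Y' ω| ≤ K) → Y ≤ᵐ[P] Y' → Y' ∈ C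
  closed : ∀ (Ys : ℕ → Ω → ℝ) (Y : Ω → ℝ) (K : ℝ), (∀ n, Ys n ∈ C) → (∀ n ω, |Ys n ω| ≤ K) →
    Measurable Y → (∀ ω, |Y ω| ≤ K) →
    (∀ᵐ ω ∂P, Tendsto (fun n => Ys n ω) atTop (𝓝 (Y ω))) → Y ∈ C

namespace IsFatouClosedUpper

variable {P : Measure Ω} [IsFiniteMeasure P] {C : Set (Ω → ℝ)}

/-- A penalty which separates the elements of `C` below `a` from zero can be modified above `a`
so as to separate the elements of `C` below `b` from zero. -/
theorem exists_penalty_extend (hC : IsFatouClosedUpper P C) {f : ℝ → ℝ} (hf : IsPenalty f)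
    {a b : ℝ} (ha : 0 ≤ a) (hab : a ≤ b)
    (h : ∀ Y ∈ C, (∀ᵐ ω ∂P, Y ω ≤ a) → 1 < ∫ ω, f (Y ω) ∂P) :
    ∃ g : ℝ → ℝ, IsPenalty g ∧ (∀ y ≤ a, g y = f y) ∧
      ∀ Y ∈ C, (∀ᵐ ω ∂P, Y ω ≤ b) → 1 < ∫ ω, g (Y ω) ∂P := by
  by_contra! hcon
  have hb : 0 ≤ b := ha.trans hab
  let g : ℕ → ℝ → ℝ := fun k y => f y + k * max (y - a) 0
  have hg : ∀ k, IsPenalty (g k) := fun k => hf.add_mul_max (Nat.cast_nonneg k) ha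
  let S : ℕ → Set (Ω → ℝ) := fun k =>
    {Y | Y ∈ C ∧ (∀ ω, 0 ≤ Y ω ∧ Y ω ≤ b) ∧ ∫ ω, g k (Y ω) ∂P ≤ 1}
  have hSb : ∀ k, ∀ Y ∈ S k, ∀ ω, |Y ω| ≤ b := fun k Y hY ω =>
    abs_le.2 ⟨by linarith [(hY.2.1 ω).1], (hY.2.1 ω).2⟩
  obtain ⟨Ys, Y, hYs, hY, hYb, hlim⟩ := exists_ae_tendsto_mem_of_antitone_convex P (S := S) (K := b)
    (by
      intro n k hnk Y hY
      refine ⟨hY.1, hY.2.1, le_trans ?_ hY.2.2⟩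
      have hm := hC.measurable Y hY.1
      refine integral_mono (integrable_comp_of_abs_le P (hg n).continuous hm (hSb k Y hY))
        (integrable_comp_of_abs_le P (hg k).continuous hm (hSb k Y hY)) fun ω => ?_
      simp only [g]
      gcongr)
    (by
      intro k
      obtain ⟨Y, hYC, hYb, hY1⟩ := hcon (g k) (hg k) fun y hy => by
        simp only [g]
        rw [max_eq_right (by linarith), mul_zero, add_zero]
      have hm : Measurable fun ω => max 0 (min (Y ω) b) :=
        measurable_const.max ((hC.measurable Y hYC).min measurable_const)
      have hbd : ∀ ω, 0 ≤ max 0 (min (Y ω) b) ∧ max 0 (min (Y ω) b) ≤ b := fun ω =>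
        ⟨le_max_left _ _, max_le hb (min_le_right _ _)⟩
      refine ⟨fun ω => max 0 (min (Y ω) b), hC.upper Y hYC _ hm
        ⟨b, fun ω => abs_le.2 ⟨by linarith [(hbd ω).1], (hbd ω).2⟩⟩ ?_, hbd, ?_⟩
      · filter_upwards [hYb] with ω hω
        rw [min_eq_left hω]
        exact le_max_right _ _
      · refine (integral_congr_ae ?_).trans_le hY1
        filter_upwards [hYb] with ω hω
        rw [min_eq_left hω]
        rcases le_total (Y ω) 0 with h0 | h0
        · rw [max_eq_left h0, (hg k).eq_zero _ h0, (hg k).eq_zero _ le_rfl]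
        · rw [max_eq_right h0])
    (by
      intro k X hX Y hY s t hs ht hst
      refine ⟨hC.convex hX.1 hY.1 hs ht hst, fun ω => ?_,
        (hg k).convex_sublevel P (hC.measurable X hX.1) (hC.measurable Y hY.1) (hSb k X hX)
          (hSb k Y hY) hs ht hst hX.2.2 hY.2.2⟩
      exact convex_Icc (0 : ℝ) b (hX.2.1 ω) (hY.2.1 ω) hs ht hst)
    (fun k Y hY => hC.measurable Y hY.1) hSb
  rw [max_eq_left hb] at hYb
  have hYsm : ∀ n, Measurable (Ys n) := fun n => hC.measurable _ (hYs n).1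
  have hYsb : ∀ n ω, |Ys n ω| ≤ b := fun n => hSb n _ (hYs n)
  have hcm : Continuous fun y : ℝ => max (y - a) 0 := by fun_prop
  have hint : ∀ n, Integrable (fun ω => f (Ys n ω)) P := fun n =>
    integrable_comp_of_abs_le P hf.continuous (hYsm n) (hYsb n)
  have hint' : ∀ n, Integrable (fun ω => max (Ys n ω - a) 0) P := fun n =>
    integrable_comp_of_abs_le P hcm (hYsm n) (hYsb n)
  have hsum : ∀ n, ∫ ω, f (Ys n ω) ∂P + n * ∫ ω, max (Ys n ω - a) 0 ∂P ≤ 1 := fun n => by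
    rw [← integral_const_mul, ← integral_add (hint n) ((hint' n).const_mul _)]
    exact (hYs n).2.2
  have hpos : ∀ n, 0 ≤ ∫ ω, f (Ys n ω) ∂P := fun n => integral_nonneg fun ω => hf.nonneg _
  have hpos' : ∀ n, 0 ≤ ∫ ω, max (Ys n ω - a) 0 ∂P := fun n =>
    integral_nonneg fun ω => le_max_right _ _
  have hYC : Y ∈ C := hC.closed Ys Y b (fun n => (hYs n).1) hYsb hY hYb hlim
  have hfY : ∫ ω, f (Y ω) ∂P ≤ 1 := by
    refine le_of_tendsto' (tendsto_integral_comp_of_abs_le P hf.continuous hYsm hYsb hlim)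
      fun n => ?_
    have := mul_nonneg (Nat.cast_nonneg (α := ℝ) n) (hpos' n)
    linarith [hsum n]
  have hzero : ∫ ω, max (Y ω - a) 0 ∂P = 0 := by
    refine tendsto_nhds_unique (tendsto_integral_comp_of_abs_le P hcm hYsm hYsb hlim)
      (squeeze_zero' (Eventually.of_forall hpos') ?_ tendsto_one_div_atTop_nhds_zero_nat)
    filter_upwards [eventually_gt_atTop 0] with n hn
    rw [le_div_iff₀ (by exact_mod_cast hn), mul_comm]
    linarith [hsum n, hpos n]
  refine (h Y hYC ?_).not_ge hfY
  rw [integral_eq_zero_iff_of_nonneg (fun ω => le_max_right (Y ω - a) 0)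
    (integrable_comp_of_abs_le P hcm hY hYb)] at hzero
  filter_upwards [hzero] with ω hω
  have : Y ω - a ≤ max (Y ω - a) 0 := le_max_left _ _
  simp only [Pi.zero_apply] at hω
  linarith

theorem exists_penalty (hC : IsFatouClosedUpper P C) (h0 : ∀ Y ∈ C, ¬ ∀ᵐ ω ∂P, Y ω ≤ 0) :
    ∃ f : ℝ → ℝ, IsPenalty f ∧ ∀ Y ∈ C, 1 < ∫ ω, f (Y ω) ∂P := by
  let Good : ℕ → Type := fun n => {f : ℝ → ℝ // IsPenalty f ∧
    ∀ Y ∈ C, (∀ᵐ ω ∂P, Y ω ≤ n) → 1 < ∫ ω, f (Y ω) ∂P}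
  have hstep : ∀ (n : ℕ) (f : Good n), ∃ g : Good (n + 1), ∀ y ≤ (n : ℝ), g.1 y = f.1 y := by
    rintro n ⟨f, hf, hfC⟩
    obtain ⟨g, hg, hgf, hgC⟩ := hC.exists_penalty_extend hf n.cast_nonneg
      (Nat.cast_le.2 n.le_succ) hfC
    exact ⟨⟨g, hg, hgC⟩, hgf⟩
  choose next hnext using hstep
  let F : ∀ n, Good n := fun n => Nat.rec
    ⟨fun _ => 0, IsPenalty.zero, fun Y hY h => absurd (by simpa using h) (h0 Y hY)⟩ next n
  have hF : ∀ n k : ℕ, n ≤ k → ∀ y ≤ (n : ℝ), (F k).1 y = (F n).1 y := by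
    intro n k hnk
    induction k, hnk using Nat.le_induction with
    | base => exact fun _ _ => rfl
    | succ k hnk ih =>
      intro y hy
      exact (hnext k (F k) y (hy.trans (Nat.cast_le.2 hnk))).trans (ih y hy)
  let φ : ℝ → ℝ := fun y => (F ⌈y⌉₊).1 y
  have hφ : ∀ (n : ℕ) (y : ℝ), y ≤ n → φ y = (F n).1 y := fun n y hy =>
    (hF _ _ (Nat.ceil_le.2 hy) y (Nat.le_ceil y)).symm
  refine ⟨φ, ⟨⟨convex_univ, ?_⟩, fun y => (F _).2.1.nonneg y, fun y hy => (F _).2.1.eq_zero y hy⟩,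
    fun Y hY => ?_⟩
  · intro x _ y _ s t hs ht hst
    have hx : x ≤ ⌈max x y⌉₊ := (le_max_left _ _).trans (Nat.le_ceil _)
    have hy : y ≤ ⌈max x y⌉₊ := (le_max_right _ _).trans (Nat.le_ceil _)
    rw [hφ _ x hx, hφ _ y hy, hφ _ _ (convex_Iic (𝕜 := ℝ) (⌈max x y⌉₊ : ℝ) hx hy hs ht hst)]
    exact (F _).2.1.convexOn.2 (mem_univ x) (mem_univ y) hs ht hst
  · obtain ⟨K, hK⟩ := hC.bounded Y hY
    have hYK : ∀ ω, Y ω ≤ ⌈K⌉₊ := fun ω => (le_abs_self _).trans ((hK ω).trans (Nat.le_ceil K))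
    simp only [hφ _ _ (hYK _)]
    exact (F ⌈K⌉₊).2.2 Y hY (ae_of_all _ hYK)

end IsFatouClosedUpper

/-- The vector space of bounded measurable real functions. -/
def boundedMeasurable (Ω : Type*) [MeasurableSpace Ω] : Submodule ℝ (Ω → ℝ) where
  carrier := {X | Measurable X ∧ ∃ K : ℝ, ∀ ω, |X ω| ≤ K}
  zero_mem' := ⟨measurable_const, 0, fun ω => by simp⟩
  add_mem' := by
    rintro X Y ⟨hX, K, hK⟩ ⟨hY, L, hL⟩
    exact ⟨hX.add hY, K + L, fun ω => (abs_add_le _ _).trans (add_le_add (hK ω) (hL ω))⟩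
  smul_mem' := by
    rintro c X ⟨hX, K, hK⟩
    refine ⟨hX.const_smul c, |c| * K, fun ω => ?_⟩
    rw [Pi.smul_apply, smul_eq_mul, abs_mul]
    exact mul_le_mul_of_nonneg_left (hK ω) (abs_nonneg c)

namespace boundedMeasurable

theorem indicator_mem {s : Set Ω} (hs : MeasurableSet s) (c : ℝ) :
    s.indicator (fun _ => c) ∈ boundedMeasurable Ω :=
  ⟨measurable_const.indicator hs, |c|, fun ω => by
    by_cases h : ω ∈ s <;> simp [h]⟩

theorem simpleFunc_mem (g : SimpleFunc Ω ℝ) : ⇑g ∈ boundedMeasurable Ω := by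
  obtain ⟨K, hK⟩ := g.exists_forall_norm_le
  exact ⟨g.measurable, K, hK⟩

/-- A positive linear functional on bounded measurable functions which is continuous along bounded
pointwise convergent sequences and does not charge null sets is given by a density. -/
theorem exists_density (P : Measure Ω) [IsFiniteMeasure P] (l : boundedMeasurable Ω →ₗ[ℝ] ℝ)
    (hpos : ∀ X : boundedMeasurable Ω, (∀ᵐ ω ∂P, X.1 ω ≤ 0) → l X ≤ 0)
    (hcont : ∀ (Xs : ℕ → boundedMeasurable Ω) (X : boundedMeasurable Ω) (K : ℝ),
      (∀ n ω, |(Xs n).1 ω| ≤ K) →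
      (∀ ω, Tendsto (fun n => (Xs n).1 ω) atTop (𝓝 (X.1 ω))) →
      Tendsto (fun n => l (Xs n)) atTop (𝓝 (l X))) :
    ∃ D : Ω → ℝ, Measurable D ∧ (∀ᵐ ω ∂P, 0 ≤ D ω) ∧ Integrable D P ∧
      ∀ X : boundedMeasurable Ω, l X = ∫ ω, D ω * X.1 ω ∂P := by
  classical
  have hnn : ∀ X : boundedMeasurable Ω, (∀ᵐ ω ∂P, 0 ≤ X.1 ω) → 0 ≤ l X := by
    intro X hX
    have h := hpos (-X) (by
      filter_upwards [hX] with ω hω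
      simpa using hω)
    rw [map_neg] at h
    linarith
  let ind : ∀ s : Set Ω, MeasurableSet s → boundedMeasurable Ω := fun s hs =>
    ⟨s.indicator fun _ => 1, indicator_mem hs 1⟩
  have hind : ∀ s hs, 0 ≤ l (ind s hs) := fun s hs =>
    hnn _ (ae_of_all _ fun ω => indicator_nonneg (fun _ _ => zero_le_one) ω)
  let ν : SignedMeasure Ω :=
    { measureOf' := fun s => if hs : MeasurableSet s then l (ind s hs) else 0
      empty' := by
        rw [dif_pos MeasurableSet.empty, ← map_zero l]
        congr 1
        ext ω
        simp [ind]
      not_measurable' := fun s hs => dif_neg hs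
      m_iUnion' := by
        intro f hf hdisj
        simp only [hf, MeasurableSet.iUnion hf, dite_true]
        rw [hasSum_iff_tendsto_nat_of_nonneg fun i => hind (f i) (hf i)]
        have hval : ∀ (n : ℕ) (ω : Ω), (∑ i ∈ Finset.range n, ind (f i) (hf i)).1 ω =
            (⋃ i ∈ Finset.range n, f i).indicator (fun _ => (1 : ℝ)) ω := by
          intro n ω
          rw [Finset.indicator_biUnion_apply _ _ fun i _ j _ hij => hdisj hij]
          simp [ind]
        simp only [← map_sum]
        refine hcont _ _ 1 (fun n ω => ?_) fun ω => ?_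
        · rw [hval, indicator_apply]
          split_ifs <;> simp
        · simp only [hval]
          exact (tendsto_indicator_biUnion_finset f (fun _ => (1 : ℝ)) ω |>.mono_right
            (pure_le_nhds _)).comp tendsto_finset_range }
  have hν : ∀ s (hs : MeasurableSet s), ν s = l (ind s hs) := fun s hs => dif_pos hs
  have hac : ν ≪ᵥ P.toENNRealVectorMeasure := by
    refine VectorMeasure.AbsolutelyContinuous.mk fun s hs h0 => ?_
    rw [Measure.toENNRealVectorMeasure_apply_measurable hs] at h0
    rw [hν s hs]
    refine le_antisymm (hpos _ ?_) (hind s hs)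
    filter_upwards [measure_eq_zero_iff_ae_notMem.1 h0] with ω hω
    simp [ind, hω]
  have hint : Integrable (ν.rnDeriv P) P := SignedMeasure.integrable_rnDeriv _ _
  have hset : ∀ s (hs : MeasurableSet s), ∫ ω in s, ν.rnDeriv P ω ∂P = l (ind s hs) := by
    intro s hs
    rw [← withDensityᵥ_apply hint hs, SignedMeasure.withDensityᵥ_rnDeriv_eq ν P hac, hν s hs]
  have hintX : ∀ X : boundedMeasurable Ω, Integrable (fun ω => ν.rnDeriv P ω * X.1 ω) P := by
    rintro ⟨X, hX, K, hK⟩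
    exact hint.mul_bdd (c := K) hX.aestronglyMeasurable (ae_of_all _ hK)
  refine ⟨ν.rnDeriv P, SignedMeasure.measurable_rnDeriv _ _,
    ae_nonneg_of_forall_setIntegral_nonneg hint fun s hs _ => (hind s hs).trans_eq (hset s hs).symm,
    hint, ?_⟩
  have hsimple : ∀ g : SimpleFunc Ω ℝ,
      l ⟨g, simpleFunc_mem g⟩ = ∫ ω, ν.rnDeriv P ω * g ω ∂P := by
    intro g
    induction g using SimpleFunc.induction with
    | const c hs =>
      rename_i s
      have h : (⟨_, simpleFunc_mem ((SimpleFunc.const Ω c).piecewise s hs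
          (SimpleFunc.const Ω 0))⟩ :
          boundedMeasurable Ω) = c • ind s hs := by
        ext ω
        by_cases h : ω ∈ s <;> simp [ind, h]
      rw [h, map_smul, ← hset s hs, smul_eq_mul, ← integral_const_mul, ← integral_indicator hs]
      refine integral_congr_ae (ae_of_all _ fun ω => ?_)
      by_cases h : ω ∈ s <;> simp [h, mul_comm]
    | add hdisj hf hg =>
      rename_i f g
      have h : (⟨_, simpleFunc_mem (f + g)⟩ : boundedMeasurable Ω) =
        ⟨f, simpleFunc_mem f⟩ + ⟨g, simpleFunc_mem g⟩ := rfl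
      rw [h, map_add, hf, hg, ← integral_add (hintX ⟨f, simpleFunc_mem f⟩)
        (hintX ⟨g, simpleFunc_mem g⟩)]
      simp [mul_add]
  rintro ⟨X, hX, K, hK⟩
  have hK' : ∀ ω, ‖X ω‖ ≤ max K 0 := fun ω => (hK ω).trans (le_max_left _ _)
  let g := hX.stronglyMeasurable.approxBounded (max K 0)
  have hg : ∀ n ω, ‖g n ω‖ ≤ max K 0 :=
    hX.stronglyMeasurable.norm_approxBounded_le (le_max_right _ _)
  have hgX : ∀ ω, Tendsto (fun n => g n ω) atTop (𝓝 (X ω)) := fun ω =>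
    hX.stronglyMeasurable.tendsto_approxBounded_of_norm_le (hK' ω)
  refine tendsto_nhds_unique (hcont (fun n => ⟨g n, simpleFunc_mem (g n)⟩) _ _ hg hgX) ?_
  simp only [hsimple]
  refine tendsto_integral_of_dominated_convergence (fun ω => ‖ν.rnDeriv P ω‖ * max K 0)
    (fun n => (hintX ⟨g n, simpleFunc_mem (g n)⟩).aestronglyMeasurable)
    (hint.norm.mul_const _) (fun n => ae_of_all _ fun ω => ?_)
    (ae_of_all _ fun ω => (hgX ω).const_mul _)
  rw [norm_mul]
  exact mul_le_mul_of_nonneg_left (hg n ω) (norm_nonneg _)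

/-- Separation of a point from a convex cone by a density, provided the translates of the point by
the cone are separated from zero by a penalty. -/
theorem exists_density_of_penalty (P : Measure Ω) [IsProbabilityMeasure P] {φ : ℝ → ℝ}
    (hφ : IsPenalty φ) (A : ConvexCone ℝ (boundedMeasurable Ω)) (hA0 : 0 ∈ A)
    (X₀ : boundedMeasurable Ω) (hX₀ : ∀ Z ∈ A, 1 < ∫ ω, φ ((X₀ - Z).1 ω) ∂P) :
    ∃ D : Ω → ℝ, Measurable D ∧ (∀ᵐ ω ∂P, 0 ≤ D ω) ∧ Integrable D P ∧
      ∫ ω, D ω * X₀.1 ω ∂P = 1 ∧ ∀ Z ∈ A, ∫ ω, D ω * Z.1 ω ∂P ≤ 0 := by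
  let U : Set (boundedMeasurable Ω) := {Y | ∃ Z ∈ A, ∫ ω, φ ((Y - Z).1 ω) ∂P ≤ 1}
  have hU0 : ∀ Y : boundedMeasurable Ω, ∫ ω, φ (Y.1 ω) ∂P ≤ 1 → Y ∈ U := fun Y hY =>
    ⟨0, hA0, by rwa [sub_zero]⟩
  have hUconv : Convex ℝ U := by
    rintro Y ⟨Z, hZ, hYZ⟩ Y' ⟨Z', hZ', hYZ'⟩ a b ha hb hab
    refine ⟨a • Z + b • Z', A.convex hZ hZ' ha hb hab, ?_⟩
    obtain ⟨K, hK⟩ := (Y - Z).2.2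
    obtain ⟨L, hL⟩ := (Y' - Z').2.2
    have h := hφ.convex_sublevel P (Y - Z).2.1 (Y' - Z').2.1 hK hL ha hb hab hYZ hYZ'
    convert h using 4
    simp
    ring
  have habs : Absorbent ℝ U := by
    rw [absorbent_iff_inv_smul]
    rintro ⟨Y, hY, K, hK⟩
    filter_upwards [tendsto_norm_cobounded_atTop.eventually_ge_atTop (max 1 (φ K))] with r hr
    have hr1 : 1 ≤ |r| := (le_max_left _ _).trans hr
    have hrφ : φ K ≤ |r| := (le_max_right _ _).trans hr
    have hr0 : 0 < |r| := one_pos.trans_le hr1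
    refine hU0 _ ?_
    refine (integral_mono_of_nonneg (ae_of_all _ fun ω => hφ.nonneg _)
      (integrable_const 1) (ae_of_all _ fun ω => ?_)).trans_eq (by simp)
    calc φ (r⁻¹ * Y ω) ≤ φ (|r|⁻¹ * K) := by
          refine hφ.monotone ((le_abs_self _).trans ?_)
          rw [abs_mul, abs_inv]
          exact mul_le_mul_of_nonneg_left (hK ω) (inv_nonneg.2 hr0.le)
      _ ≤ |r|⁻¹ * φ K := hφ.apply_mul_le (inv_nonneg.2 hr0.le) (inv_le_one_of_one_le₀ hr1) K
      _ ≤ 1 := by rwa [inv_mul_le_iff₀ hr0, mul_one]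
  have h0U : (0 : boundedMeasurable Ω) ∈ U := hU0 0 (by simp [hφ.eq_zero 0 le_rfl])
  have hX₀U : X₀ ∉ U := fun ⟨Z, hZ, h⟩ => (hX₀ Z hZ).not_ge h
  have hX₀0 : X₀ ≠ 0 := (ne_of_mem_of_not_mem h0U hX₀U).symm
  obtain ⟨l, hl₁, hl₂⟩ := exists_extension_of_le_sublinear (LinearPMap.mkSpanSingleton X₀ 1 hX₀0)
    (gauge U) (fun c hc => gauge_smul_of_nonneg hc.le) (gauge_add_le hUconv habs) (by
      rintro ⟨x, hx⟩
      obtain ⟨y, rfl⟩ := Submodule.mem_span_singleton.1 hx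
      rw [LinearPMap.mkSpanSingleton'_apply]
      simp only [mul_one, smul_eq_mul, RingHom.id_apply]
      obtain h | h := le_or_gt y 0
      · exact h.trans (gauge_nonneg _)
      · rw [gauge_smul_of_nonneg h.le, smul_eq_mul, le_mul_iff_one_le_right h]
        exact one_le_gauge_of_notMem (hUconv.starConvex h0U) habs.absorbs hX₀U)
  have hlX₀ : l X₀ = 1 :=
    (hl₁ ⟨X₀, Submodule.mem_span_singleton_self _⟩).trans
      (LinearPMap.mkSpanSingleton'_apply_self _ _ _ _)
  have hle : ∀ (Y : boundedMeasurable Ω) (r : ℝ), 0 < r → r⁻¹ • Y ∈ U → l Y ≤ r :=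
    fun Y r hr hY => (hl₂ Y).trans
      (gauge_le_of_mem hr.le ((mem_smul_set_iff_inv_smul_mem₀ hr.ne' _ _).2 hY))
  have hlA : ∀ Z ∈ A, l Z ≤ 0 := fun Z hZ => le_of_forall_pos_le_add fun r hr => by
    rw [zero_add]
    exact hle Z r hr ⟨r⁻¹ • Z, A.smul_mem (inv_pos.2 hr) hZ, by simp [hφ.eq_zero 0 le_rfl]⟩
  obtain ⟨D, hD, hD0, hDi, hDl⟩ := exists_density P l
    (fun Y hY => le_of_forall_pos_le_add fun r hr => by
      rw [zero_add]
      refine hle Y r hr (hU0 _ ?_)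
      rw [integral_eq_zero_of_ae]
      · exact zero_le_one
      · filter_upwards [hY] with ω hω
        exact hφ.eq_zero _ (mul_nonpos_of_nonneg_of_nonpos (inv_nonneg.2 hr.le) hω))
    (fun Xs X K hK hlim => by
      have key : ∀ s : ℝ, ∀ r > 0, ∀ᶠ n in atTop, l (s • (Xs n - X)) ≤ r := by
        intro s r hr
        have hcont : Continuous fun y : ℝ => φ (r⁻¹ * (s * y)) := by
          have := hφ.continuous
          fun_prop
        obtain ⟨L, hL⟩ := X.2.2
        have h := tendsto_integral_comp_of_abs_le P hcont (Ys := fun n => (Xs n - X).1)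
          (Y := fun _ => 0) (fun n => (Xs n - X).2.1) (K := K + L)
          (fun n ω => (abs_sub _ _).trans (add_le_add (hK n ω) (hL ω)))
          (ae_of_all _ fun ω => by simpa using (hlim ω).sub_const (X.1 ω))
        simp only [mul_zero, hφ.eq_zero 0 le_rfl, integral_zero] at h
        filter_upwards [h.eventually_le_const one_pos] with n hn
        exact hle _ r hr (hU0 _ hn)
      rw [Metric.tendsto_nhds]
      intro ε hε
      filter_upwards [key 1 (ε / 2) (half_pos hε), key (-1) (ε / 2) (half_pos hε)] with n h1 h2
      rw [one_smul, map_sub] at h1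
      rw [map_smul, map_sub, smul_eq_mul] at h2
      rw [Real.dist_eq, abs_lt]
      constructor <;> linarith)
  exact ⟨D, hD, hD0, hDi, by rw [← hDl, hlX₀], fun Z hZ => by rw [← hDl]; exact hlA Z hZ⟩

end boundedMeasurable

/-- Fatou continuous coherent risk measures on bounded measurable functions. -/
structure IsFatouCoherent (P : Measure Ω) (ρ : (Ω → ℝ) → ℝ) : Prop where
  cash : ∀ (X : Ω → ℝ) (c : ℝ), Measurable X → (∃ C : ℝ, ∀ ω, |X ω| ≤ C) →
    ρ (fun ω => X ω + c) = ρ X + c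
  mono : ∀ X Y : Ω → ℝ, Measurable X → (∃ C : ℝ, ∀ ω, |X ω| ≤ C) → Measurable Y →
    (∃ C : ℝ, ∀ ω, |Y ω| ≤ C) → (∀ᵐ ω ∂P, X ω ≤ Y ω) → ρ X ≤ ρ Y
  conv : ∀ X Y : Ω → ℝ, Measurable X → (∃ C : ℝ, ∀ ω, |X ω| ≤ C) → Measurable Y →
    (∃ C : ℝ, ∀ ω, |Y ω| ≤ C) → ∀ lam : ℝ, 0 ≤ lam → lam ≤ 1 →
    ρ (fun ω => lam * X ω + (1 - lam) * Y ω) ≤ lam * ρ X + (1 - lam) * ρ Y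
  smul : ∀ X : Ω → ℝ, Measurable X → (∃ C : ℝ, ∀ ω, |X ω| ≤ C) → ∀ lam : ℝ, 0 ≤ lam →
    ρ (fun ω => lam * X ω) = lam * ρ X
  fatou : ∀ (Xs : ℕ → Ω → ℝ) (X : Ω → ℝ) (C : ℝ), (∀ n, Measurable (Xs n)) →
    (∀ n ω, |Xs n ω| ≤ C) → Measurable X → (∀ ω, |X ω| ≤ C) →
    (∀ᵐ ω ∂P, Tendsto (fun n => Xs n ω) atTop (𝓝 (X ω))) →
    ρ X ≤ liminf (fun n => ρ (Xs n)) atTop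

namespace IsFatouCoherent

variable {P : Measure Ω} {ρ : (Ω → ℝ) → ℝ}

theorem map_zero (hρ : IsFatouCoherent P ρ) : ρ 0 = 0 := by
  have h := hρ.smul 0 measurable_zero ⟨0, fun ω => by simp⟩ 0 le_rfl
  rw [zero_mul] at h
  rw [← h]
  congr 1
  ext ω
  simp

theorem map_add_le (hρ : IsFatouCoherent P ρ) (X Y : boundedMeasurable Ω) :
    ρ (X + Y).1 ≤ ρ X.1 + ρ Y.1 := by
  have h1 := hρ.conv X.1 Y.1 X.2.1 X.2.2 Y.2.1 Y.2.2 (1 / 2) (by norm_num) (by norm_num)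
  have h2 := hρ.smul (X + Y).1 (X + Y).2.1 (X + Y).2.2 (1 / 2) (by norm_num)
  have h3 : (fun ω => 1 / 2 * (X + Y).1 ω) = fun ω => 1 / 2 * X.1 ω + (1 - 1 / 2) * Y.1 ω := by
    ext ω
    simp
    ring
  rw [h3] at h2
  linarith

/-- The acceptance cone of a coherent risk measure. -/
def acceptanceCone (hρ : IsFatouCoherent P ρ) : ConvexCone ℝ (boundedMeasurable Ω) where
  carrier := {Z | ρ Z.1 ≤ 0}
  smul_mem' c hc Z hZ :=
    (hρ.smul Z.1 Z.2.1 Z.2.2 c hc.le).trans_le (mul_nonpos_of_nonneg_of_nonpos hc.le hZ)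
  add_mem' X hX Y hY := (hρ.map_add_le X Y).trans (add_nonpos hX hY)

theorem isFatouClosedUpper (hρ : IsFatouCoherent P ρ) (X₀ : boundedMeasurable Ω) :
    IsFatouClosedUpper P {Y | Y ∈ boundedMeasurable Ω ∧ ρ (X₀.1 - Y) ≤ 0} where
  measurable Y hY := hY.1.1
  bounded Y hY := hY.1.2
  convex := by
    rintro Y ⟨hY, hYρ⟩ Y' ⟨hY', hYρ'⟩ a b ha hb hab
    have h1 := sub_mem X₀.2 hY
    have h2 := sub_mem X₀.2 hY'
    obtain rfl : b = 1 - a := by linarith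
    refine ⟨add_mem (Submodule.smul_mem _ _ hY) (Submodule.smul_mem _ _ hY'), ?_⟩
    have h := hρ.conv _ _ h1.1 h1.2 h2.1 h2.2 a ha (by linarith)
    have h3 : X₀.1 - (a • Y + (1 - a) • Y') =
        fun ω => a * (X₀.1 - Y) ω + (1 - a) * (X₀.1 - Y') ω := by
      ext ω
      simp
      ring
    rw [h3]
    exact h.trans (add_nonpos (mul_nonpos_of_nonneg_of_nonpos ha hYρ)
      (mul_nonpos_of_nonneg_of_nonpos hb hYρ'))
  upper := by
    rintro Y ⟨hY, hYρ⟩ Y' hm hb hle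
    have h1 := sub_mem X₀.2 hY
    have h2 := sub_mem X₀.2 (show Y' ∈ boundedMeasurable Ω from ⟨hm, hb⟩)
    refine ⟨⟨hm, hb⟩, (hρ.mono _ _ h2.1 h2.2 h1.1 h1.2 ?_).trans hYρ⟩
    filter_upwards [hle] with ω hω
    exact sub_le_sub_left hω _
  closed := by
    intro Ys Y K hYs hK hY hYK hlim
    obtain ⟨L, hL⟩ := X₀.2.2
    refine ⟨⟨hY, K, hYK⟩, (hρ.fatou (fun n => X₀.1 - Ys n) (X₀.1 - Y) (L + K)
      (fun n => X₀.2.1.sub (hYs n).1.1)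
      (fun n ω => (abs_sub _ _).trans (add_le_add (hL ω) (hK n ω))) (X₀.2.1.sub hY)
      (fun ω => (abs_sub _ _).trans (add_le_add (hL ω) (hYK ω))) ?_).trans ?_⟩
    · filter_upwards [hlim] with ω hω
      exact hω.const_sub _
    · rw [liminf_eq]
      refine Real.sSup_nonpos fun a ha => ?_
      obtain ⟨n, hn⟩ := Eventually.exists ha
      exact hn.trans (hYs n).2

/-- The dual representation: a Fatou continuous coherent risk measure is the supremum of the
expectations over its supporting set. -/
theorem exists_suppMem_lt (hρ : IsFatouCoherent P ρ) [IsProbabilityMeasure P] {X : Ω → ℝ}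
    (hX : X ∈ boundedMeasurable Ω) {c : ℝ} (hc : c < ρ X) :
    ∃ D, SuppMem P ρ D ∧ c < ∫ ω, D ω * X ω ∂P := by
  have hshift : ∀ {Z : Ω → ℝ}, Z ∈ boundedMeasurable Ω → ∀ a : ℝ,
      (fun ω => Z ω + a) ∈ boundedMeasurable Ω := fun hZ a =>
    add_mem hZ (show (fun _ => a) ∈ boundedMeasurable Ω from ⟨measurable_const, |a|, fun _ => le_rfl⟩)
  let X₀ : boundedMeasurable Ω := ⟨fun ω => X ω + -c, hshift hX _⟩
  have hX₀ : 0 < ρ X₀.1 := by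
    rw [hρ.cash X (-c) hX.1 hX.2]
    linarith
  obtain ⟨φ, hφ, hφC⟩ := (hρ.isFatouClosedUpper X₀).exists_penalty (by
    rintro Y ⟨hY, hYρ⟩ hY0
    have h1 := sub_mem X₀.2 hY
    refine (hX₀.trans_le (hρ.mono _ _ X₀.2.1 X₀.2.2 h1.1 h1.2 ?_)).not_ge hYρ
    filter_upwards [hY0] with ω hω
    rw [Pi.sub_apply]
    linarith)
  obtain ⟨D, hD, hD0, hDi, hDX₀, hDA⟩ := boundedMeasurable.exists_density_of_penalty P hφ
    hρ.acceptanceCone hρ.map_zero.le X₀ (fun Z hZ => hφC _ ⟨(X₀ - Z).2, by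
      have h : X₀.1 - (X₀ - Z).1 = Z.1 := by simp
      rw [h]
      exact hZ⟩)
  have hDm : ∀ Z ∈ boundedMeasurable Ω, Integrable (fun ω => D ω * Z ω) P := by
    rintro Z ⟨hZ, K, hK⟩
    exact hDi.mul_bdd (c := K) hZ.aestronglyMeasurable (ae_of_all _ hK)
  have hadd : ∀ Z ∈ boundedMeasurable Ω, ∀ a : ℝ,
      ∫ ω, D ω * (Z ω + a) ∂P = ∫ ω, D ω * Z ω ∂P + (∫ ω, D ω ∂P) * a := by
    intro Z hZ a
    simp only [mul_add]
    rw [integral_add (hDm Z hZ) (hDi.mul_const a), integral_mul_const]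
  have hle : ∀ Z ∈ boundedMeasurable Ω, ∫ ω, D ω * Z ω ∂P ≤ (∫ ω, D ω ∂P) * ρ Z := by
    intro Z hZ
    have h := hDA ⟨fun ω => Z ω + -ρ Z, hshift hZ _⟩
      (((hρ.cash Z _ hZ.1 hZ.2).trans (add_neg_cancel _)).le)
    rw [hadd Z hZ] at h
    linarith
  have hpos : 0 < ∫ ω, D ω ∂P := by
    refine (integral_nonneg_of_ae hD0).lt_of_ne' fun h0 => ?_
    have h := hle X₀.1 X₀.2
    rw [hDX₀, h0, zero_mul] at h
    exact absurd h (by norm_num)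
  set p := ∫ ω, D ω ∂P with hp
  have hscale : ∀ Z : Ω → ℝ, ∫ ω, p⁻¹ * D ω * Z ω ∂P = p⁻¹ * ∫ ω, D ω * Z ω ∂P := fun Z => by
    simp only [mul_assoc]
    rw [integral_const_mul]
  refine ⟨fun ω => p⁻¹ * D ω, ⟨hD.const_mul _, ?_, hDi.const_mul _, ?_, fun Z hZ hZb => ?_⟩, ?_⟩
  · filter_upwards [hD0] with ω hω
    exact mul_nonneg (inv_nonneg.2 hpos.le) hω
  · rw [integral_const_mul, ← hp, inv_mul_cancel₀ hpos.ne']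
  · rw [hscale, inv_mul_le_iff₀ hpos]
    exact hle Z ⟨hZ, hZb⟩
  · rw [hscale, lt_inv_mul_iff₀ hpos]
    have h := hadd X hX (-c)
    have h1 : ∫ ω, D ω * (X ω + -c) ∂P = 1 := hDX₀
    linarith

end IsFatouCoherent

theorem SuppMem.convex (P : Measure Ω) (ρ : (Ω → ℝ) → ℝ) : Convex ℝ {D | SuppMem P ρ D} := by
  rintro D ⟨hm, h0, hi, h1, hρ⟩ D' ⟨hm', h0', hi', h1', hρ'⟩ a b ha hb hab
  refine ⟨(hm.const_smul a).add (hm'.const_smul b), ?_, (hi.smul a).add (hi'.smul b), ?_,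
    fun X hX hXb => ?_⟩
  · filter_upwards [h0, h0'] with ω hω hω'
    exact add_nonneg (mul_nonneg ha hω) (mul_nonneg hb hω')
  · simp only [Pi.add_apply, Pi.smul_apply, smul_eq_mul]
    rw [integral_add (hi.const_mul a) (hi'.const_mul b), integral_const_mul, integral_const_mul,
      h1, h1', mul_one, mul_one, hab]
  · have hX1 := hρ X hX hXb
    have hX2 := hρ' X hX hXb
    obtain ⟨K, hK⟩ := hXb
    have hI : ∀ {F : Ω → ℝ}, Integrable F P → Integrable (fun ω => F ω * X ω) P := fun hF =>
      hF.mul_bdd (c := K) hX.aestronglyMeasurable (ae_of_all _ hK)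
    simp only [Pi.add_apply, Pi.smul_apply, smul_eq_mul, add_mul, mul_assoc]
    rw [integral_add ((hI hi).const_mul a) ((hI hi').const_mul b), integral_const_mul,
      integral_const_mul]
    calc _ ≤ a * ρ X + b * ρ X := by gcongr
      _ = ρ X := by rw [← add_mul, hab, one_mul]

/-- Conditional expectation is self-adjoint against bounded functions measurable for the
sub-σ-algebra. -/
theorem integral_condExp_mul {Ω : Type*} {m mΩ : MeasurableSpace Ω} (hm : m ≤ mΩ) (P : Measure Ω)
    [IsFiniteMeasure P] {D X : Ω → ℝ} (hD : Integrable D P) (hX : StronglyMeasurable[m] X)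
    (hXb : ∃ C : ℝ, ∀ ω, |X ω| ≤ C) :
    ∫ ω, (P[D|m]) ω * X ω ∂P = ∫ ω, D ω * X ω ∂P := by
  obtain ⟨K, hK⟩ := hXb
  have hi : Integrable (D * X) P :=
    hD.mul_bdd (c := K) (hX.mono hm).aestronglyMeasurable (ae_of_all _ hK)
  rw [← integral_condExp hm (f := fun ω => D ω * X ω)]
  exact integral_congr_ae (condExp_mul_of_stronglyMeasurable_right hX hi hD).symm

end

/-- the restriction of a Fatou coherent risk measure to L^∞(𝓖) is a Fatou
coherent risk measure, the restricted supporting set 𝒮_ρ^𝓖 is contained in 𝒮_{ρ̃}, and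
𝒮_ρ^𝓖 is w(𝓜(𝓖),L^∞(𝓖))-dense in 𝒮_{ρ̃}. -/
theorem stmt_5 {Ω : Type*} (m : MeasurableSpace Ω) {mΩ : MeasurableSpace Ω} (hm : m ≤ mΩ)
    (ℙ : Measure Ω) [IsProbabilityMeasure ℙ] (ρ : (Ω → ℝ) → ℝ)
    (hcash : ∀ (X : Ω → ℝ) (c : ℝ), Measurable X → (∃ C : ℝ, ∀ ω, |X ω| ≤ C) →
      ρ (fun ω => X ω + c) = ρ X + c)
    (hmono : ∀ X Y : Ω → ℝ, Measurable X → (∃ C : ℝ, ∀ ω, |X ω| ≤ C) → Measurable Y →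
      (∃ C : ℝ, ∀ ω, |Y ω| ≤ C) → (∀ᵐ ω ∂ℙ, X ω ≤ Y ω) → ρ X ≤ ρ Y)
    (hconv : ∀ X Y : Ω → ℝ, Measurable X → (∃ C : ℝ, ∀ ω, |X ω| ≤ C) → Measurable Y →
      (∃ C : ℝ, ∀ ω, |Y ω| ≤ C) → ∀ lam : ℝ, 0 ≤ lam → lam ≤ 1 →
      ρ (fun ω => lam * X ω + (1 - lam) * Y ω) ≤ lam * ρ X + (1 - lam) * ρ Y)
    (hph : ∀ X : Ω → ℝ, Measurable X → (∃ C : ℝ, ∀ ω, |X ω| ≤ C) → ∀ lam : ℝ, 0 ≤ lam →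
      ρ (fun ω => lam * X ω) = lam * ρ X)
    (hFatou : ∀ (Xs : ℕ → Ω → ℝ) (X : Ω → ℝ) (C : ℝ), (∀ n, Measurable (Xs n)) →
      (∀ n ω, |Xs n ω| ≤ C) → Measurable X → (∀ ω, |X ω| ≤ C) →
      (∀ᵐ ω ∂ℙ, Filter.Tendsto (fun n => Xs n ω) Filter.atTop (nhds (X ω))) →
      ρ X ≤ Filter.liminf (fun n => ρ (Xs n)) Filter.atTop) :
    -- (A) the restriction ρ̃ = ρ|_{L^∞(𝓖)} is a Fatou coherent risk measure
    ((∀ (X : Ω → ℝ) (c : ℝ), StronglyMeasurable[m] X → (∃ C : ℝ, ∀ ω, |X ω| ≤ C) →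
        ρ (fun ω => X ω + c) = ρ X + c)
      ∧ (∀ X Y : Ω → ℝ, StronglyMeasurable[m] X → (∃ C : ℝ, ∀ ω, |X ω| ≤ C) →
          StronglyMeasurable[m] Y → (∃ C : ℝ, ∀ ω, |Y ω| ≤ C) →
          (∀ᵐ ω ∂ℙ, X ω ≤ Y ω) → ρ X ≤ ρ Y)
      ∧ (∀ X Y : Ω → ℝ, StronglyMeasurable[m] X → (∃ C : ℝ, ∀ ω, |X ω| ≤ C) →
          StronglyMeasurable[m] Y → (∃ C : ℝ, ∀ ω, |Y ω| ≤ C) →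
          ∀ lam : ℝ, 0 ≤ lam → lam ≤ 1 →
          ρ (fun ω => lam * X ω + (1 - lam) * Y ω) ≤ lam * ρ X + (1 - lam) * ρ Y)
      ∧ (∀ X : Ω → ℝ, StronglyMeasurable[m] X → (∃ C : ℝ, ∀ ω, |X ω| ≤ C) →
          ∀ lam : ℝ, 0 ≤ lam → ρ (fun ω => lam * X ω) = lam * ρ X)
      ∧ (∀ (Xs : ℕ → Ω → ℝ) (X : Ω → ℝ) (C : ℝ), (∀ n, StronglyMeasurable[m] (Xs n)) →
          (∀ n ω, |Xs n ω| ≤ C) → StronglyMeasurable[m] X → (∀ ω, |X ω| ≤ C) →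
          (∀ᵐ ω ∂ℙ, Filter.Tendsto (fun n => Xs n ω) Filter.atTop (nhds (X ω))) →
          ρ X ≤ Filter.liminf (fun n => ρ (Xs n)) Filter.atTop))
    -- (B) 𝒮_ρ^𝓖 ⊆ 𝒮_{ρ̃}
    ∧ (∀ D : Ω → ℝ, SuppMem ℙ ρ D → SuppMemG m ℙ ρ (ℙ[D|m]))
    -- (C) 𝒮_ρ^𝓖 is dense in 𝒮_{ρ̃} for the weak topology w(𝓜(𝓖),L^∞(𝓖))
    ∧ (∀ E : Ω → ℝ, SuppMemG m ℙ ρ E → ∀ ε : ℝ, 0 < ε → ∀ (k : ℕ) (Xs : Fin k → Ω → ℝ),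
        (∀ i, StronglyMeasurable[m] (Xs i) ∧ ∃ C : ℝ, ∀ ω, |Xs i ω| ≤ C) →
        ∃ D : Ω → ℝ, SuppMem ℙ ρ D ∧
          ∀ i, |(∫ ω, (ℙ[D|m]) ω * Xs i ω ∂ℙ) - ∫ ω, E ω * Xs i ω ∂ℙ| < ε) := by
  have hρ : IsFatouCoherent ℙ ρ := ⟨hcash, hmono, hconv, hph, hFatou⟩
  refine ⟨⟨fun X c hX => hcash X c (hX.mono hm).measurable,
    fun X Y hX hXb hY => hmono X Y (hX.mono hm).measurable hXb (hY.mono hm).measurable,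
    fun X Y hX hXb hY => hconv X Y (hX.mono hm).measurable hXb (hY.mono hm).measurable,
    fun X hX => hph X (hX.mono hm).measurable,
    fun Xs X C hXs hC hX => hFatou Xs X C (fun n => ((hXs n).mono hm).measurable) hC
      (hX.mono hm).measurable⟩, ?_, ?_⟩
  · rintro D ⟨-, hD0, hDi, hD1, hDρ⟩
    refine ⟨stronglyMeasurable_condExp, condExp_nonneg hD0, integrable_condExp,
      (integral_condExp hm).trans hD1, fun X hX hXb => ?_⟩
    rw [integral_condExp_mul hm ℙ hDi hX hXb]
    exact hDρ X (hX.mono hm).measurable hXb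
  · rintro E ⟨-, -, hEi, -, hEρ⟩ ε hε k Xs hXs
    have hXi : ∀ {F : Ω → ℝ}, Integrable F ℙ → ∀ i, Integrable (fun ω => F ω * Xs i ω) ℙ := by
      intro F hF i
      obtain ⟨hX, K, hK⟩ := hXs i
      exact hF.mul_bdd (c := K) (hX.mono hm).aestronglyMeasurable (Filter.Eventually.of_forall hK)
    let ev : (Ω → ℝ) → Fin k → ℝ := fun F i => ∫ ω, F ω * Xs i ω ∂ℙ
    let T : Set (Fin k → ℝ) := ev '' {D | SuppMem ℙ ρ D}
    have hT : Convex ℝ T := by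
      rintro _ ⟨D, hD, rfl⟩ _ ⟨D', hD', rfl⟩ a b ha hb hab
      refine ⟨a • D + b • D', SuppMem.convex ℙ ρ hD hD' ha hb hab, ?_⟩
      ext i
      simp only [ev, Pi.add_apply, Pi.smul_apply, smul_eq_mul, add_mul, mul_assoc]
      rw [integral_add ((hXi hD.2.2.1 i).const_mul a) ((hXi hD'.2.2.1 i).const_mul b),
        integral_const_mul, integral_const_mul]
    have hE : ev E ∈ closure T := by
      by_contra hE
      obtain ⟨f, u, hfu, huf⟩ := geometric_hahn_banach_closed_point hT.closure isClosed_closure hE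
      let a : Fin k → ℝ := fun i => f (Pi.single i 1)
      let Y : Ω → ℝ := fun ω => ∑ i, a i * Xs i ω
      have hf : ∀ {F : Ω → ℝ}, Integrable F ℙ → f (ev F) = ∫ ω, F ω * Y ω ∂ℙ := by
        intro F hF
        have h1 : f (ev F) = ∑ i, ev F i * a i := by
          conv_lhs => rw [pi_eq_sum_univ' (ev F)]
          simp [a, map_sum]
        rw [h1]
        simp only [Y, Finset.mul_sum]
        rw [integral_finsetSum]
        · refine Finset.sum_congr rfl fun i _ => ?_
          rw [← integral_mul_const]
          exact integral_congr_ae (Filter.Eventually.of_forall fun ω => by ring)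
        · intro i _
          exact ((hXi hF i).const_mul (a i)).congr (Filter.Eventually.of_forall fun ω => by ring)
      have hYm : StronglyMeasurable[m] Y :=
        Finset.stronglyMeasurable_fun_sum _ fun i _ => (hXs i).1.const_mul (a i)
      have hYB : Y ∈ boundedMeasurable Ω := by
        have h : Y = ∑ i, a i • Xs i := by
          ext ω
          simp [Y]
        rw [h]
        exact Submodule.sum_mem _ fun i _ => Submodule.smul_mem _ _
          ⟨((hXs i).1.mono hm).measurable, (hXs i).2⟩
      have hu : u < ρ Y := by
        rw [hf hEi] at huf
        exact huf.trans_le (hEρ Y hYm hYB.2)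
      obtain ⟨D, hD, hDu⟩ := hρ.exists_suppMem_lt hYB hu
      have h := hfu _ (subset_closure ⟨D, hD, rfl⟩)
      rw [hf hD.2.2.1] at h
      exact lt_asymm h hDu
    obtain ⟨_, ⟨D, hD, rfl⟩, hdist⟩ := Metric.mem_closure_iff.1 hE ε hε
    refine ⟨D, hD, fun i => ?_⟩
    rw [integral_condExp_mul hm ℙ hD.2.2.1 (hXs i).1 (hXs i).2, ← Real.dist_eq, dist_comm]
    exact (dist_le_pi_dist (ev E) (ev D) i).trans_lt hdist
end

section
/- Let (Ω,𝓕,ℙ) be a probability space with sub-σ-algebra 𝓖 such that (Ω,𝓖,ℙ) is atomless. Let X ∈ L^∞, Y ∈ L^1 and Z ∈ L^1(𝓖) with Y and Z identically distributed under ℙ. Then there exists a 𝓖-measurable W ∈ L^∞ such that W is identically distributed as X under ℙ and 𝔼[XY] = 𝔼[WZ]. -/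
open MeasureTheory

section

open Set Filter Topology ProbabilityTheory

theorem exists_measurable_measure_preimage_singleton_eq_zero {Ω : Type*} [MeasurableSpace Ω]
    (μ : Measure Ω) [IsProbabilityMeasure μ]
    (hμ : ∀ A : Set Ω, MeasurableSet A → 0 < μ A →
      ∃ B : Set Ω, MeasurableSet B ∧ B ⊆ A ∧ 0 < μ B ∧ μ B < μ A) :
    ∃ h : Ω → ℝ, Measurable h ∧ ∀ x, μ (h ⁻¹' {x}) = 0 := by
  let a : (Ω → ℝ) → ENNReal := fun h => ∫⁻ ω, μ (h ⁻¹' {h ω}) ∂μ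
  have ha_mono : ∀ g h : Ω → ℝ, (∀ ω ω', g ω = g ω' → h ω = h ω') → a g ≤ a h := fun g h H =>
    lintegral_mono fun ω => measure_mono fun ω' hω' => H _ _ hω'
  have ha_meas : ∀ h : Ω → ℝ, Measurable h → Measurable fun ω => μ (h ⁻¹' {h ω}) := by
    intro h hh
    have hs : MeasurableSet {p : Ω × Ω | h p.2 = h p.1} :=
      measurableSet_eq_fun (hh.comp measurable_snd) (hh.comp measurable_fst)
    exact measurable_measure_prodMk_left hs
  obtain ⟨u, -, hu, hus⟩ := exists_seq_tendsto_sInf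
    (S := a '' {h | Measurable h}) ⟨_, _, measurable_const (a := (0 : ℝ)), rfl⟩ (OrderBot.bddBelow _)
  choose h hh hhu using hus
  let g : Ω → ℝ := fun ω => embeddingReal (ℕ → ℝ) fun n => h n ω
  have hg : Measurable g :=
    (measurable_embeddingReal _).comp (measurable_pi_lambda _ fun n => hh n)
  have hg_min : ∀ k : Ω → ℝ, Measurable k → a g ≤ a k := by
    intro k hk
    refine le_trans (ge_of_tendsto' hu fun n => ?_) (sInf_le ⟨k, hk, rfl⟩)
    rw [← hhu n]
    refine ha_mono _ _ fun ω ω' H => ?_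
    exact congrFun ((measurableEmbedding_embeddingReal (ℕ → ℝ)).injective H) n
  refine ⟨g, hg, fun x => ?_⟩
  by_contra hx
  have hA : MeasurableSet (g ⁻¹' {x}) := hg (measurableSet_singleton x)
  obtain ⟨B, hB, hBA, hB0, hBlt⟩ := hμ _ hA (pos_iff_ne_zero.2 hx)
  let k : Ω → ℝ := fun ω => embeddingReal (ℝ × ℝ) (g ω, B.indicator 1 ω)
  have hk : Measurable k :=
    (measurable_embeddingReal _).comp (hg.prodMk (measurable_one.indicator hB))
  have hk_eq : ∀ ω ω', k ω = k ω' → g ω = g ω' ∧ B.indicator (1 : Ω → ℝ) ω = B.indicator 1 ω' :=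
    fun ω ω' H => Prod.ext_iff.1 ((measurableEmbedding_embeddingReal (ℝ × ℝ)).injective H)
  have hlt : a k < a g := by
    refine lintegral_strict_mono_of_ae_le_of_ae_lt_on (ha_meas g hg).aemeasurable ?_ ?_ hB0.ne' ?_
    · refine ne_top_of_le_ne_top ENNReal.one_ne_top ?_
      calc a k ≤ ∫⁻ _, 1 ∂μ := lintegral_mono fun ω => prob_le_one
        _ = 1 := by simp
    · exact ae_of_all _ fun ω => measure_mono fun ω' hω' => (hk_eq _ _ hω').1
    · refine ae_of_all _ fun ω hω => ?_
      have hgω : g ω = x := hBA hω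
      rw [hgω]
      refine lt_of_le_of_lt (measure_mono fun ω' hω' => ?_) hBlt
      have := (hk_eq _ _ hω').2
      by_contra hc
      simp [hω, hc] at this
  exact (hg_min k hk).not_gt hlt

theorem exists_measurable_noAtoms_comonotone {Ω : Type*} [MeasurableSpace Ω]
    (μ : Measure Ω) [IsProbabilityMeasure μ]
    (hμ : ∀ A : Set Ω, MeasurableSet A → 0 < μ A →
      ∃ B : Set Ω, MeasurableSet B ∧ B ⊆ A ∧ 0 < μ B ∧ μ B < μ A)
    {Z : Ω → ℝ} (hZ : Measurable Z) :
    ∃ V : Ω → ℝ, Measurable V ∧ (∀ x, μ (V ⁻¹' {x}) = 0) ∧ ∀ ω ω', V ω ≤ V ω' → Z ω ≤ Z ω' := by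
  obtain ⟨h, hh, hh0⟩ := exists_measurable_measure_preimage_singleton_eq_zero μ hμ
  let L : ℝ → ℝ := fun z => μ.real (Z ⁻¹' Iio z)
  let G : ℝ → ℝ := fun z => μ.real (Z ⁻¹' Iic z)
  let s : Ω → ℝ := fun ω => Real.sigmoid (h ω)
  have hs0 : ∀ ω, 0 < s ω := fun ω => Real.sigmoid_pos _
  have hs1 : ∀ ω, s ω < 1 := fun ω => Real.sigmoid_lt_one _
  have hL : Monotone L := fun x y hxy =>
    measureReal_mono (preimage_mono (Iio_subset_Iio hxy))
  have hG : Monotone G := fun x y hxy =>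
    measureReal_mono (preimage_mono (Iic_subset_Iic.2 hxy))
  have hGL : ∀ x y, x < y → G x ≤ L y := fun x y hxy =>
    measureReal_mono (preimage_mono (Iic_subset_Iio.2 hxy))
  have hLG : ∀ x, L x ≤ G x := fun x => measureReal_mono (preimage_mono Iio_subset_Iic_self)
  let V : Ω → ℝ := fun ω => Z ω + L (Z ω) + (G (Z ω) - L (Z ω)) * s ω
  have hs : Measurable s := Real.sigmoid_strictMono.monotone.measurable.comp hh
  have hV : Measurable V := (hZ.add (hL.measurable.comp hZ)).add
    (((hG.measurable.comp hZ).sub (hL.measurable.comp hZ)).mul hs)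
  have hVZ : ∀ ω ω', V ω ≤ V ω' → Z ω ≤ Z ω' := by
    intro ω ω' hle
    by_contra! hlt
    have h1 := hGL _ _ hlt
    have h2 := mul_nonneg (sub_nonneg.2 (hLG (Z ω))) (hs0 ω).le
    have h3 := mul_nonneg (sub_nonneg.2 (hLG (Z ω'))) (sub_nonneg.2 (hs1 ω').le)
    simp only [V] at hle
    linarith
  refine ⟨V, hV, fun x => ?_, hVZ⟩
  rcases (V ⁻¹' {x}).eq_empty_or_nonempty with he | ⟨ω₀, hω₀⟩
  · simp [he]
  have hZeq : ∀ ω ∈ V ⁻¹' {x}, Z ω = Z ω₀ := fun ω hω =>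
    le_antisymm (hVZ _ _ (hω.trans hω₀.symm).le) (hVZ _ _ (hω₀.trans hω.symm).le)
  by_cases hp : μ (Z ⁻¹' {Z ω₀}) = 0
  · exact measure_mono_null hZeq hp
  · have hGLlt : 0 < G (Z ω₀) - L (Z ω₀) := by
      have : G (Z ω₀) - L (Z ω₀) = μ.real (Z ⁻¹' {Z ω₀}) := by
        simp only [G, L]
        rw [← measureReal_sdiff (preimage_mono Iio_subset_Iic_self) (hZ measurableSet_Iio),
          ← preimage_sdiff, Iic_sdiff_Iio_same]
      rw [this]
      exact ENNReal.toReal_pos hp (measure_ne_top _ _)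
    refine measure_mono_null (fun ω hω => ?_) (hh0 (h ω₀))
    have h1 : V ω = V ω₀ := hω.trans hω₀.symm
    simp only [V, hZeq ω hω, add_right_inj] at h1
    exact Real.sigmoid_injective (mul_left_cancel₀ hGLlt.ne' h1)

theorem map_cdf_eq_volume_restrict (ν : Measure ℝ) [IsProbabilityMeasure ν]
    (hν : ∀ x, ν {x} = 0) : ν.map (cdf ν) = volume.restrict (Icc 0 1) := by
  have hcont : Continuous (cdf ν) := by
    refine continuous_iff_continuousAt.2 fun x => ?_
    rw [(monotone_cdf ν).continuousAt_iff_leftLim_eq_rightLim, StieltjesFunction.rightLim_eq]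
    have h1 := (cdf ν).measure_singleton x
    rw [measure_cdf, hν] at h1
    have h2 := ENNReal.ofReal_eq_zero.1 h1.symm
    exact le_antisymm ((monotone_cdf ν).leftLim_le le_rfl) (by linarith)
  have := Measure.isProbabilityMeasure_map (μ := ν) hcont.measurable.aemeasurable
  refine Measure.ext_of_Iic _ _ fun t => ?_
  rw [Measure.map_apply hcont.measurable measurableSet_Iic, Measure.restrict_apply measurableSet_Iic]
  rcases lt_or_ge t 0 with ht0 | ht0
  · have h1 : cdf ν ⁻¹' Iic t = ∅ :=
      eq_empty_of_forall_notMem fun x hx => absurd (hx.trans_lt ht0) (cdf_nonneg ν x).not_gt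
    have h2 : Iic t ∩ Icc 0 1 = ∅ :=
      eq_empty_of_forall_notMem fun x hx => absurd (hx.1.trans_lt ht0) hx.2.1.not_gt
    rw [h1, h2]; simp
  rcases le_or_gt 1 t with ht1 | ht1
  · have h1 : cdf ν ⁻¹' Iic t = univ := eq_univ_of_forall fun x => (cdf_le_one ν x).trans ht1
    have h2 : Iic t ∩ Icc 0 1 = Icc 0 1 := inter_eq_right.2 fun x hx => hx.2.trans ht1
    rw [h1, h2]; simp
  have h2 : Iic t ∩ Icc 0 1 = Icc 0 t := by
    ext x; simp only [mem_inter_iff, mem_Iic, mem_Icc]; constructor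
    · rintro ⟨a, b, c⟩; exact ⟨b, a⟩
    · rintro ⟨a, b⟩; exact ⟨b, a, b.trans ht1.le⟩
  rw [h2, Real.volume_Icc, sub_zero]
  obtain ⟨b, hb⟩ := ((tendsto_cdf_atTop ν).eventually (lt_mem_nhds ht1)).exists
  have hbdd : BddAbove (cdf ν ⁻¹' Iic t) := ⟨b, fun x hx => by
    by_contra! hlt
    exact absurd (hb.trans_le (monotone_cdf ν hlt.le)) (not_lt.2 hx)⟩
  rcases (cdf ν ⁻¹' Iic t).eq_empty_or_nonempty with he | hne
  · have : t ≤ 0 := ge_of_tendsto' (tendsto_cdf_atBot ν) fun x => by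
      by_contra! hlt
      exact (he ▸ (show x ∈ cdf ν ⁻¹' Iic t from hlt.le) : x ∈ (∅ : Set ℝ))
    rw [he, measure_empty, ENNReal.ofReal_of_nonpos this]
  set x := sSup (cdf ν ⁻¹' Iic t)
  have hx : cdf ν x ≤ t := (isClosed_Iic.preimage hcont).csSup_mem hne hbdd
  have hset : cdf ν ⁻¹' Iic t = Iic x := by
    ext y
    exact ⟨fun hy => le_csSup hbdd hy, fun hy => (monotone_cdf ν hy).trans hx⟩
  have hxt : t ≤ cdf ν x := by
    refine ge_of_tendsto (hcont.continuousAt.tendsto.mono_left nhdsWithin_le_nhds :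
      Tendsto (cdf ν) (𝓝[>] x) _) ?_
    filter_upwards [self_mem_nhdsWithin] with y hy
    by_contra! hlt
    exact absurd (le_csSup hbdd hlt.le) (not_le.2 hy)
  rw [hset, ← ofReal_cdf, le_antisymm hx hxt]

theorem exists_uniform_comonotone {Ω : Type*} [MeasurableSpace Ω]
    (μ : Measure Ω) [IsProbabilityMeasure μ]
    (hμ : ∀ A : Set Ω, MeasurableSet A → 0 < μ A →
      ∃ B : Set Ω, MeasurableSet B ∧ B ⊆ A ∧ 0 < μ B ∧ μ B < μ A)
    {Z : Ω → ℝ} (hZ : Measurable Z) :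
    ∃ U : Ω → ℝ, Measurable U ∧ μ.map U = volume.restrict (Icc 0 1) ∧ (∀ ω, U ω ∈ Icc 0 1) ∧
      ∀ ω ω', U ω < U ω' → Z ω ≤ Z ω' := by
  obtain ⟨V, hV, hV0, hVZ⟩ := exists_measurable_noAtoms_comonotone μ hμ hZ
  have := Measure.isProbabilityMeasure_map (μ := μ) hV.aemeasurable
  have hc := (monotone_cdf (μ.map V))
  refine ⟨fun ω => cdf (μ.map V) (V ω), hc.measurable.comp hV, ?_,
    fun ω => ⟨cdf_nonneg _ _, cdf_le_one _ _⟩, fun ω ω' h => hVZ _ _ (hc.reflect_lt h).le⟩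
  rw [← map_cdf_eq_volume_restrict (μ.map V) fun x => by
    rw [Measure.map_apply hV (measurableSet_singleton x), hV0], Measure.map_map hc.measurable hV]
  rfl

theorem integral_mul_eq_integral_setIntegral_preimage_Ioi {Ω : Type*} [MeasurableSpace Ω]
    (μ : Measure Ω) [IsProbabilityMeasure μ] {W Z : Ω → ℝ} {C : ℝ} (hW : Measurable W)
    (hWC : ∀ ω, |W ω| ≤ C) (hZ : Integrable Z μ) :
    IntegrableOn (fun s => ∫ ω in W ⁻¹' Ioi s, Z ω ∂μ) (Ioc (-C) C) ∧
    ∫ ω, W ω * Z ω ∂μ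
      = (∫ s in Ioc (-C) C, ∫ ω in W ⁻¹' Ioi s, Z ω ∂μ) - C * ∫ ω, Z ω ∂μ := by
  let f : Ω → ℝ → ℝ := fun ω s => (W ⁻¹' Ioi s).indicator Z ω
  have hf : Integrable (Function.uncurry f) (μ.prod (volume.restrict (Ioc (-C) C))) := by
    have hs : MeasurableSet {p : Ω × ℝ | p.2 < W p.1} :=
      measurableSet_lt measurable_snd (hW.comp measurable_fst)
    exact (hZ.comp_fst (volume.restrict (Ioc (-C) C))).indicator hs
  have hset : ∀ s, ∫ ω in W ⁻¹' Ioi s, Z ω ∂μ = ∫ ω, f ω s ∂μ := fun s =>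
    (integral_indicator (hW measurableSet_Ioi)).symm
  have hinner : ∀ ω, ∫ s in Ioc (-C) C, f ω s = (W ω + C) * Z ω := by
    intro ω
    have h1 : f ω = (Iio (W ω)).indicator fun _ => Z ω := rfl
    have h2 : Ioc (-C) C ∩ Iio (W ω) = Ioo (-C) (W ω) := by
      ext x
      exact ⟨fun h => ⟨h.1.1, h.2⟩, fun h => ⟨⟨h.1, h.2.le.trans (abs_le.1 (hWC ω)).2⟩, h.2⟩⟩
    rw [h1, setIntegral_indicator measurableSet_Iio, h2, setIntegral_const,
      Real.volume_real_Ioo_of_le (abs_le.1 (hWC ω)).1, sub_neg_eq_add, smul_eq_mul]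
  have hWZ : Integrable (fun ω => W ω * Z ω) μ :=
    hZ.bdd_mul hW.aestronglyMeasurable (ae_of_all _ hWC)
  simp_rw [hset]
  refine ⟨hf.integral_prod_right, ?_⟩
  rw [← integral_integral_swap hf]
  simp_rw [hinner, add_mul]
  rw [integral_add hWZ (hZ.const_mul C), integral_const_mul]
  ring

theorem setIntegral_le_setIntegral_of_comonotone {Ω Ω' : Type*} [MeasurableSpace Ω]
    [MeasurableSpace Ω'] (μ : Measure Ω) (ν : Measure Ω') [IsProbabilityMeasure μ]
    [IsProbabilityMeasure ν] {Y : Ω' → ℝ} {Z : Ω → ℝ} (hY : Integrable Y ν) (hZ : Integrable Z μ)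
    (hYZ : IdentDistrib Y Z ν μ) {A : Set Ω'} {B : Set Ω} (hA : MeasurableSet A)
    (hB : MeasurableSet B) (hAB : ν A = μ B) (hBZ : ∀ ω ∈ B, ∀ ω' ∉ B, Z ω' ≤ Z ω) :
    ∫ ω in A, Y ω ∂ν ≤ ∫ ω in B, Z ω ∂μ := by
  rcases B.eq_empty_or_nonempty with rfl | ⟨b, hb⟩
  · simp [Measure.restrict_eq_zero.2 (hAB.trans measure_empty)]
  rcases Bᶜ.eq_empty_or_nonempty with hB' | ⟨b', hb'⟩
  · rw [compl_empty_iff.1 hB'] at hAB ⊢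
    have hA' : A =ᵐ[ν] univ := by
      rw [ae_eq_univ, prob_compl_eq_zero_iff hA, hAB, measure_univ]
    rw [setIntegral_congr_set hA', setIntegral_univ, setIntegral_univ, hYZ.integral_eq]
  let c := sSup (Z '' Bᶜ)
  have hcB : ∀ ω ∈ B, c ≤ Z ω := fun ω hω =>
    csSup_le (Set.Nonempty.image Z ⟨b', hb'⟩) (by rintro _ ⟨ω', h', rfl⟩; exact hBZ ω hω ω' h')
  have hcB' : ∀ ω ∉ B, Z ω ≤ c := fun ω hω =>
    le_csSup ⟨Z b, by rintro _ ⟨ω', h', rfl⟩; exact hBZ b hb ω' h'⟩ ⟨ω, hω, rfl⟩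
  have hφ : Measurable fun y : ℝ => max (y - c) 0 := by fun_prop
  have hpos : ∫ ω, max (Y ω - c) 0 ∂ν = ∫ ω, max (Z ω - c) 0 ∂μ := (hYZ.comp hφ).integral_eq
  have hYc : Integrable (fun ω => Y ω - c) ν := hY.sub (integrable_const c)
  have h1 : ∫ ω in A, (Y ω - c) ∂ν ≤ ∫ ω, max (Y ω - c) 0 ∂ν :=
    (setIntegral_mono hYc.integrableOn hYc.pos_part.integrableOn fun ω => le_max_left _ _).trans
      (setIntegral_le_integral hYc.pos_part (ae_of_all _ fun ω => le_max_right _ _))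
  have h2 : ∫ ω in B, (Z ω - c) ∂μ = ∫ ω, max (Z ω - c) 0 ∂μ := by
    rw [← integral_indicator hB]
    congr 1 with ω
    by_cases hω : ω ∈ B
    · rw [indicator_of_mem hω, max_eq_left (sub_nonneg.2 (hcB ω hω))]
    · rw [indicator_of_notMem hω, max_eq_right (sub_nonpos.2 (hcB' ω hω))]
  have h3 : ∫ ω in A, (Y ω - c) ∂ν = ∫ ω in A, Y ω ∂ν - ν.real A * c := by
    rw [integral_sub hY.integrableOn (integrable_const c).integrableOn, setIntegral_const,
      smul_eq_mul]
  have h4 : ∫ ω in B, (Z ω - c) ∂μ = ∫ ω in B, Z ω ∂μ - μ.real B * c := by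
    rw [integral_sub hZ.integrableOn (integrable_const c).integrableOn, setIntegral_const,
      smul_eq_mul]
  have h5 : ν.real A = μ.real B := congrArg ENNReal.toReal hAB
  rw [h5] at h3
  linarith

theorem integral_mul_le_integral_mul_of_comonotone {Ω Ω' : Type*} [MeasurableSpace Ω]
    [MeasurableSpace Ω'] (μ : Measure Ω) (ν : Measure Ω') [IsProbabilityMeasure μ]
    [IsProbabilityMeasure ν] {X Y : Ω' → ℝ} {W Z : Ω → ℝ} {C : ℝ} (hX : Measurable X)
    (hXC : ∀ ω, |X ω| ≤ C) (hW : Measurable W) (hWC : ∀ ω, |W ω| ≤ C)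
    (hY : Integrable Y ν) (hZ : Integrable Z μ)
    (hXW : IdentDistrib X W ν μ) (hYZ : IdentDistrib Y Z ν μ)
    (hWZ : ∀ ω ω', W ω < W ω' → Z ω ≤ Z ω') :
    ∫ ω, X ω * Y ω ∂ν ≤ ∫ ω, W ω * Z ω ∂μ := by
  obtain ⟨hi, he⟩ := integral_mul_eq_integral_setIntegral_preimage_Ioi ν hX hXC hY
  obtain ⟨hi', he'⟩ := integral_mul_eq_integral_setIntegral_preimage_Ioi μ hW hWC hZ
  rw [he, he', hYZ.integral_eq]
  refine sub_le_sub_right (integral_mono hi hi' fun s => ?_) _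
  exact setIntegral_le_setIntegral_of_comonotone μ ν hY hZ hYZ (hX measurableSet_Ioi)
    (hW measurableSet_Ioi) (hXW.measure_preimage_eq measurableSet_Ioi)
    fun ω hω ω' hω' => hWZ _ _ (lt_of_le_of_lt (not_lt.1 hω') hω)

theorem exists_monotone_map_volume_Icc_eq (ν : Measure ℝ) [IsProbabilityMeasure ν] {C : ℝ}
    (hC : ν (Icc (-C) C)ᶜ = 0) :
    ∃ q : ℝ → ℝ, Monotone q ∧ (∀ u, |q u| ≤ C) ∧ (volume.restrict (Icc 0 1)).map q = ν := by
  have hF0 : ∀ x < -C, cdf ν x = 0 := fun x hx => by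
    rw [cdf_eq_real, measureReal_def, measure_mono_null (fun y hy h => ?_) hC, ENNReal.toReal_zero]
    exact absurd (h.1.trans hy) hx.not_ge
  have hF1 : ∀ x, C ≤ x → cdf ν x = 1 := fun x hx => by
    have : ν (Iic x) = 1 := by
      rw [← prob_compl_eq_zero_iff measurableSet_Iic]
      exact measure_mono_null (compl_subset_compl.2 fun y hy => hy.2.trans hx) hC
    rw [cdf_eq_real, measureReal_def, this, ENNReal.toReal_one]
  have hC0 : -C ≤ C := by
    by_contra! h
    simp [Icc_eq_empty h.not_ge] at hC
  let S : ℝ → Set ℝ := fun u => {x ∈ Icc (-C) C | min u 1 ≤ cdf ν x}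
  have hCS : ∀ u, C ∈ S u := fun u =>
    ⟨⟨hC0, le_rfl⟩, (min_le_right _ _).trans (hF1 C le_rfl).ge⟩
  have hSb : ∀ u, BddBelow (S u) := fun u => ⟨-C, fun x hx => hx.1.1⟩
  let q : ℝ → ℝ := fun u => sInf (S u)
  have hq : Monotone q := fun u v huv => csInf_le_csInf (hSb u) ⟨C, hCS v⟩
    fun x hx => ⟨hx.1, (min_le_min_right 1 huv).trans hx.2⟩
  have hqC : ∀ u, q u ∈ Icc (-C) C := fun u =>
    ⟨le_csInf ⟨C, hCS u⟩ fun x hx => hx.1.1, csInf_le (hSb u) (hCS u)⟩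
  have hgc : ∀ u ≤ 1, ∀ x, -C ≤ x → (q u ≤ x ↔ u ≤ cdf ν x) := by
    intro u hu x hx
    refine ⟨fun h => ?_, fun h => ?_⟩
    · refine le_trans ?_ (monotone_cdf ν h)
      refine ge_of_tendsto (((cdf ν).right_continuous (q u)).tendsto.mono_left
        (nhdsWithin_mono _ Ioi_subset_Ici_self)) ?_
      filter_upwards [self_mem_nhdsWithin] with y hy
      obtain ⟨z, hz, hzy⟩ := exists_lt_of_csInf_lt ⟨C, hCS u⟩ hy
      have := hz.2
      rw [min_eq_left hu] at this
      exact this.trans (monotone_cdf ν hzy.le)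
    · rcases le_total x C with hxC | hxC
      · exact csInf_le (hSb u) ⟨⟨hx, hxC⟩, (min_le_left _ _).trans h⟩
      · exact (hqC u).2.trans hxC
  refine ⟨q, hq, fun u => abs_le.2 (hqC u), Eq.symm ?_⟩
  refine Measure.ext_of_Iic _ _ fun x => ?_
  rw [Measure.map_apply hq.measurable measurableSet_Iic,
    Measure.restrict_apply (hq.measurable measurableSet_Iic)]
  rcases lt_or_ge x (-C) with hx | hx
  · have : q ⁻¹' Iic x = ∅ :=
      eq_empty_of_forall_notMem fun u hu => absurd ((hqC u).1.trans hu) hx.not_ge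
    rw [this, ← ofReal_cdf, hF0 x hx]
    simp
  · have : q ⁻¹' Iic x ∩ Icc 0 1 = Icc 0 (cdf ν x) := by
      ext u
      exact ⟨fun h => ⟨h.2.1, (hgc u h.2.2 x hx).1 h.1⟩, fun h =>
        have hu := h.2.trans (cdf_le_one ν x)
        ⟨(hgc u hu x hx).2 h.2, h.1, hu⟩⟩
    rw [this, Real.volume_Icc, sub_zero, ofReal_cdf]

/-- The reflection `u ↦ 1 - u` of the interval of radius `p` around `1 / 2`. -/
noncomputable def partialReflection (p u : ℝ) : ℝ := if |u - 1 / 2| ≤ p then 1 - u else u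

theorem measurable_partialReflection (p : ℝ) : Measurable (partialReflection p) :=
  Measurable.ite (measurableSet_le (by fun_prop) measurable_const) (by fun_prop) measurable_id

theorem measurePreserving_partialReflection (p : ℝ) :
    MeasurePreserving (partialReflection p) (volume.restrict (Icc 0 1))
      (volume.restrict (Icc 0 1)) := by
  have hR : MeasurePreserving (fun u : ℝ => 1 - u) (volume.restrict (Icc 0 1))
      (volume.restrict (Icc 0 1)) := by
    have h := (Measure.measurePreserving_sub_left volume (1 : ℝ)).restrict_preimage
      (measurableSet_Icc (a := (0 : ℝ)) (b := 1))
    have h' : (fun u : ℝ => 1 - u) ⁻¹' Icc 0 1 = Icc 0 1 := by simp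
    rwa [h'] at h
  let D : Set ℝ := {u | |u - 1 / 2| ≤ p}
  have hD : MeasurableSet D := measurableSet_le (by fun_prop) measurable_const
  have hRD : (fun u : ℝ => 1 - u) ⁻¹' D = D := by
    ext u
    simp only [D, mem_preimage, mem_ofPred_eq]
    rw [show 1 - u - 1 / 2 = -(u - 1 / 2) by ring, abs_neg]
  refine ⟨measurable_partialReflection p, Measure.ext fun S hS => ?_⟩
  rw [Measure.map_apply (measurable_partialReflection p) hS, ← measure_inter_add_sdiff _ hD,
    ← measure_inter_add_sdiff S hD, ← hR.measure_preimage (hS.inter hD).nullMeasurableSet,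
    preimage_inter, hRD]
  congr 2
  · ext u
    refine and_congr_left fun hu : |u - 1 / 2| ≤ p => ?_
    simp only [mem_preimage, partialReflection, if_pos hu]
  · ext u
    refine and_congr_left fun hu : ¬ |u - 1 / 2| ≤ p => ?_
    simp only [mem_preimage, partialReflection, if_neg hu]

theorem exists_identDistrib_integral_mul_eq {Ω Ω' : Type*} [MeasurableSpace Ω]
    [MeasurableSpace Ω'] (μ : Measure Ω) (ν : Measure Ω') [IsProbabilityMeasure μ]
    [IsProbabilityMeasure ν]
    (hμ : ∀ A : Set Ω, MeasurableSet A → 0 < μ A →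
      ∃ B : Set Ω, MeasurableSet B ∧ B ⊆ A ∧ 0 < μ B ∧ μ B < μ A)
    {X Y : Ω' → ℝ} {Z : Ω → ℝ} {C : ℝ} (hX : Measurable X) (hXC : ∀ ω, |X ω| ≤ C)
    (hY : Integrable Y ν) (hZm : Measurable Z) (hZ : Integrable Z μ)
    (hYZ : IdentDistrib Y Z ν μ) :
    ∃ W : Ω → ℝ, Measurable W ∧ (∀ ω, |W ω| ≤ C) ∧ IdentDistrib X W ν μ ∧
      ∫ ω, X ω * Y ω ∂ν = ∫ ω, W ω * Z ω ∂μ := by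
  obtain ⟨U, hU, hUmap, hU01, hUZ⟩ := exists_uniform_comonotone μ hμ hZm
  have := Measure.isProbabilityMeasure_map (μ := ν) hX.aemeasurable
  obtain ⟨q, hq, hqC, hqmap⟩ := exists_monotone_map_volume_Icc_eq (ν.map X) (C := C) (by
    rw [Measure.map_apply hX measurableSet_Icc.compl]
    convert measure_empty (μ := ν)
    exact eq_empty_of_forall_notMem fun ω hω => hω (abs_le.1 (hXC ω)))
  let W : ℝ → Ω → ℝ := fun p ω => q (partialReflection p (U ω))
  have hW : ∀ p, Measurable (W p) := fun p =>
    hq.measurable.comp ((measurable_partialReflection p).comp hU)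
  have hWC : ∀ p ω, |W p ω| ≤ C := fun p ω => hqC _
  have hXW : ∀ p, IdentDistrib X (W p) ν μ := fun p => by
    refine ⟨hX.aemeasurable, (hW p).aemeasurable, ?_⟩
    have h1 : μ.map (W p) = ((μ.map U).map (partialReflection p)).map q := by
      rw [Measure.map_map (measurable_partialReflection p) hU,
        Measure.map_map hq.measurable ((measurable_partialReflection p).comp hU)]
      rfl
    rw [h1, hUmap, (measurePreserving_partialReflection p).map_eq, hqmap]
  have hcont : Continuous fun p => ∫ ω, W p ω * Z ω ∂μ := by
    refine continuous_iff_continuousAt.2 fun p => ?_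
    refine continuousAt_of_dominated (bound := fun ω => C * |Z ω|)
      (Eventually.of_forall fun p => ((hW p).mul hZm).aestronglyMeasurable)
      (Eventually.of_forall fun p => ae_of_all _ fun ω => ?_) (hZ.abs.const_mul C) ?_
    · rw [Real.norm_eq_abs, abs_mul]
      exact mul_le_mul_of_nonneg_right (hWC p ω) (abs_nonneg _)
    · have hnull : ∀ x, ∀ᵐ ω ∂μ, U ω ≠ x := fun x => by
        change μ {ω | ¬ U ω ≠ x} = 0
        have : {ω | ¬ U ω ≠ x} = U ⁻¹' {x} := by ext; simp
        rw [this, ← Measure.map_apply hU (measurableSet_singleton x), hUmap, measure_singleton]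
      filter_upwards [hnull (1 / 2 + p), hnull (1 / 2 - p)] with ω h1 h2
      refine ContinuousAt.mul_const ?_ _
      have hne : |U ω - 1 / 2| ≠ p := fun h => by
        rcases eq_or_eq_neg_of_abs_eq h with h | h
        · exact h1 (by linarith)
        · exact h2 (by linarith)
      have hloc : ∀ᶠ p' in 𝓝 p, W p' ω = W p ω := by
        rcases hne.lt_or_gt with h | h
        · filter_upwards [lt_mem_nhds h] with p' hp'
          simp only [W, partialReflection, if_pos h.le, if_pos hp'.le]
        · filter_upwards [gt_mem_nhds h] with p' hp'
          simp only [W, partialReflection, if_neg h.not_ge, if_neg hp'.not_ge]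
      exact continuousAt_const.congr (hloc.mono fun _ h => h.symm)
  have hupper : ∫ ω, X ω * Y ω ∂ν ≤ ∫ ω, W (-1) ω * Z ω ∂μ := by
    refine integral_mul_le_integral_mul_of_comonotone μ ν hX hXC (hW _) (hWC _) hY hZ (hXW _) hYZ
      fun ω ω' h => hUZ _ _ ?_
    have hT : ∀ u, partialReflection (-1) u = u := fun u =>
      if_neg fun h => absurd ((abs_nonneg _).trans h) (by norm_num)
    simp only [W, hT] at h
    exact hq.reflect_lt h
  have hlower : ∫ ω, W 1 ω * Z ω ∂μ ≤ ∫ ω, X ω * Y ω ∂ν := by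
    have hneg := integral_mul_le_integral_mul_of_comonotone (X := fun ω => -X ω)
      (W := fun ω => -W 1 ω) μ ν hX.neg (by simpa using hXC) (hW 1).neg (by simpa using hWC 1)
      hY hZ ((hXW 1).comp measurable_neg) hYZ fun ω ω' h => hUZ _ _ ?_
    · simp only [neg_mul, integral_neg] at hneg
      exact neg_le_neg_iff.1 hneg
    have hT : ∀ ω, partialReflection 1 (U ω) = 1 - U ω := fun ω =>
      if_pos (abs_le.2 ⟨by linarith [(hU01 ω).1], by linarith [(hU01 ω).2]⟩)
    simp only [W, hT] at h
    linarith [hq.reflect_lt (neg_lt_neg_iff.1 h)]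
  obtain ⟨p, hp⟩ := mem_range_of_exists_le_of_exists_ge hcont ⟨1, hlower⟩ ⟨-1, hupper⟩
  exact ⟨W p, hW p, hWC p, hXW p, hp.symm⟩

end

/-- if (Ω,𝓖,ℙ) is atomless, X ∈ L^∞, Y ∈ L¹ and Z ∈ L¹(𝓖) with Y and Z
identically distributed, then there is a 𝓖-measurable W ∈ L^∞ identically distributed as X
with 𝔼[XY] = 𝔼[WZ]. -/
theorem stmt_11 {Ω : Type*} (m : MeasurableSpace Ω) {mΩ : MeasurableSpace Ω} (hm : m ≤ mΩ)
    (ℙ : Measure Ω) [IsProbabilityMeasure ℙ]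
    (hatomless : ∀ A : Set Ω, MeasurableSet[m] A → 0 < ℙ A →
      ∃ B : Set Ω, MeasurableSet[m] B ∧ B ⊆ A ∧ 0 < ℙ B ∧ ℙ B < ℙ A)
    (X Y Z : Ω → ℝ) (hX : Measurable X) (hXb : ∃ C : ℝ, ∀ ω, |X ω| ≤ C)
    (hY : Measurable Y) (hYint : Integrable Y ℙ)
    (hZ : StronglyMeasurable[m] Z) (hZint : Integrable Z ℙ)
    (hYZ : Measure.map Y ℙ = Measure.map Z ℙ) :
    ∃ W : Ω → ℝ, StronglyMeasurable[m] W ∧ (∃ C : ℝ, ∀ ω, |W ω| ≤ C) ∧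
      Measure.map W ℙ = Measure.map X ℙ ∧
      (∫ ω, X ω * Y ω ∂ℙ) = ∫ ω, W ω * Z ω ∂ℙ := by
  obtain ⟨C, hC⟩ := hXb
  have hZm : Measurable[m] Z := hZ.measurable
  have hmap : ∀ V : Ω → ℝ, Measurable[m] V →
      @Measure.map Ω ℝ m _ V (ℙ.trim hm) = Measure.map V ℙ := fun V hV => by
    refine Measure.ext fun S hS => ?_
    rw [Measure.map_apply hV hS, Measure.map_apply (hV.mono hm le_rfl) hS,
      trim_measurableSet_eq hm (hV hS)]
  have hat : ∀ A : Set Ω, MeasurableSet[m] A → 0 < ℙ.trim hm A →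
      ∃ B : Set Ω, MeasurableSet[m] B ∧ B ⊆ A ∧ 0 < ℙ.trim hm B ∧ ℙ.trim hm B < ℙ.trim hm A := by
    intro A hA hA0
    rw [trim_measurableSet_eq hm hA] at hA0
    obtain ⟨B, hB, hBA, hB0, hBlt⟩ := hatomless A hA hA0
    refine ⟨B, hB, hBA, ?_⟩
    rw [trim_measurableSet_eq hm hA, trim_measurableSet_eq hm hB]
    exact ⟨hB0, hBlt⟩
  have : IsProbabilityMeasure (ℙ.trim hm) :=
    ⟨by rw [trim_measurableSet_eq hm MeasurableSet.univ, measure_univ]⟩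
  obtain ⟨W, hW, hWC, ⟨-, -, hXW⟩, hint⟩ :=
    @exists_identDistrib_integral_mul_eq Ω Ω m mΩ (ℙ.trim hm) ℙ _ _ hat X Y Z C hX hC hYint hZm
    (hZint.trim hm hZ) (@ProbabilityTheory.IdentDistrib.mk Ω Ω ℝ mΩ m _ Y Z ℙ (ℙ.trim hm)
      hY.aemeasurable hZm.aemeasurable (hYZ.trans (hmap Z hZm).symm))
  have hWm : StronglyMeasurable[m] W := hW.stronglyMeasurable
  refine ⟨W, hWm, ⟨C, hWC⟩, ?_, ?_⟩
  · rw [← hmap W hW, hXW]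
  · rw [hint]
    exact (integral_trim hm (hWm.mul hZ)).symm
end
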